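/- Let μ denote the Möbius function and let u be the Möbius sequence u_n = μ(n) regarded as a sequence of complex numbers. Let A ∈ GL(2, ℤ), a ∈ 𝕋² = ℝ²/ℤ², and let T : 𝕋² → 𝕋² be the affine map T(x) = Ax + a. If the topological entropy of T is zero, then the Möbius sequence is linearly disjoint from T: for every continuous function f : 𝕋² → ℂ and every x ∈ 𝕋², (1/N) ∑_{n=1}^{N} μ(n) · f(Tⁿ x) → 0 as N → ∞. -/

import Mathlib

open Filter Polynomial

noncomputable section

/-- The `d`-torus `ℝ^d/ℤ^d`, as a product of copies of `ℝ/ℤ`. -/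
abbrev Torus (d : ℕ) := Fin d → AddCircle (1 : ℝ)

/-- The affine map `x ↦ A x + a` on the `d`-torus, for an integer matrix `A`. -/
def torusAffine {d : ℕ} (A : Matrix (Fin d) (Fin d) ℤ) (a : Torus d) (x : Torus d) : Torus d :=
  fun i => (∑ j, A i j • x j) + a i

/-- `c` is a higher order oscillating sequence of order `m` (stronger version): for some
`λ > 1` the averages of `|c n|^λ` converge to a finite limit, and for every real-coefficient
polynomial `P` of degree at most `m` the averages of `c n · e^{2πi P(n)}` tend to `0`. -/
def HigherOrderOscillating (c : ℕ → ℂ) (m : ℕ) : Prop :=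
  (∃ lam : ℝ, 1 < lam ∧ ∃ K : ℝ,
    Tendsto (fun N : ℕ => (1 / N : ℝ) * ∑ n ∈ Finset.Icc 1 N, ‖c n‖ ^ lam) atTop (nhds K)) ∧
  ∀ P : Polynomial ℝ, P.degree ≤ m →
    Tendsto (fun N : ℕ => (1 / N : ℂ) * ∑ n ∈ Finset.Icc 1 N,
      c n * Complex.exp (2 * Real.pi * Complex.I * (P.eval (n : ℝ)))) atTop (nhds 0)

/-- `c` is linearly disjoint from the flow `T`: for every continuous `f : X → ℂ` and every
`x ∈ X`, `(1/N) ∑_{n=1}^N c n · f(Tⁿ x) → 0` as `N → ∞`. -/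
def LinearlyDisjoint {X : Type*} [TopologicalSpace X] (c : ℕ → ℂ) (T : X → X) : Prop :=
  ∀ f : X → ℂ, Continuous f → ∀ x : X,
    Tendsto (fun N : ℕ => (1 / N : ℂ) * ∑ n ∈ Finset.Icc 1 N, c n * f (T^[n] x)) atTop (nhds 0)



lemma gen_CS {ι : Type*} [DecidableEq ι] (I : Finset ι) (v : ι → ℕ → ℕ → ℂ) (w : ℕ → ℂ) (D : ℝ)
    (hw : ∀ n, ‖w n‖ ≤ 1)
    (hoff : ∀ i ∈ I, ∀ j ∈ I, i ≠ j →
      (fun N : ℕ => ∑ n ∈ Finset.Icc 1 N, v i N n * (starRingEnd ℂ) (v j N n)) =o[atTop]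
        (fun N : ℕ => (N : ℝ)))
    (hdiag : ∀ N, ∑ i ∈ I, ∑ n ∈ Finset.Icc 1 N, ‖v i N n‖ ^ 2 ≤ D * N) (ε : ℝ) (hε : 0 < ε) :
    ∀ᶠ N : ℕ in atTop, ‖∑ n ∈ Finset.Icc 1 N, w n * ∑ i ∈ I, v i N n‖ ^ 2 ≤ (N:ℝ) ^ 2 * (D + ε) := by
  have hO : (fun N : ℕ => ∑ i ∈ I, ∑ j ∈ I.erase i, ∑ n ∈ Finset.Icc 1 N,
      v i N n * (starRingEnd ℂ) (v j N n)) =o[atTop] (fun N : ℕ => (N : ℝ)) := by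
    apply Asymptotics.IsLittleO.fun_sum
    intro i hi
    apply Asymptotics.IsLittleO.fun_sum
    intro j hj
    exact hoff i hi j (Finset.mem_of_mem_erase hj) (Finset.ne_of_mem_erase hj).symm
  have := (Asymptotics.isLittleO_iff.mp hO) hε
  filter_upwards [this] with N hN
  have h1 : ‖∑ n ∈ Finset.Icc 1 N, w n * ∑ i ∈ I, v i N n‖ ≤
      ∑ n ∈ Finset.Icc 1 N, ‖∑ i ∈ I, v i N n‖ := by
    refine (norm_sum_le _ _).trans (Finset.sum_le_sum fun n _ => ?_)
    rw [norm_mul]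
    exact mul_le_of_le_one_left (norm_nonneg _) (hw n)
  have h2 : (∑ n ∈ Finset.Icc 1 N, ‖∑ i ∈ I, v i N n‖) ^ 2 ≤
      N * ∑ n ∈ Finset.Icc 1 N, ‖∑ i ∈ I, v i N n‖ ^ 2 := by
    have := sq_sum_le_card_mul_sum_sq (s := Finset.Icc 1 N) (f := fun n => ‖∑ i ∈ I, v i N n‖)
    simpa using this
  have h3 : ((∑ n ∈ Finset.Icc 1 N, ‖∑ i ∈ I, v i N n‖ ^ 2 : ℝ) : ℂ) =
      ((∑ i ∈ I, ∑ n ∈ Finset.Icc 1 N, ‖v i N n‖ ^ 2 : ℝ) : ℂ) +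
      ∑ i ∈ I, ∑ j ∈ I.erase i, ∑ n ∈ Finset.Icc 1 N,
      v i N n * (starRingEnd ℂ) (v j N n) := by
    push_cast
    rw [← Finset.sum_add_distrib]
    simp_rw [← Complex.mul_conj', map_sum, Finset.sum_mul_sum]
    rw [Finset.sum_comm]
    refine Finset.sum_congr rfl fun i hi => ?_
    rw [Finset.sum_comm, ← Finset.add_sum_erase _ _ hi]
  have h4 : ∑ n ∈ Finset.Icc 1 N, ‖∑ i ∈ I, v i N n‖ ^ 2 ≤ D * N + ε * N := by
    have h5 : ‖((∑ n ∈ Finset.Icc 1 N, ‖∑ i ∈ I, v i N n‖ ^ 2 : ℝ) : ℂ)‖ ≤ D * N + ε * N := by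
      rw [h3]
      refine (norm_add_le _ _).trans (add_le_add ?_ ?_)
      · rw [Complex.norm_real, Real.norm_of_nonneg (by positivity)]
        exact hdiag N
      · simpa using hN
    rw [Complex.norm_real, Real.norm_of_nonneg (by positivity)] at h5
    exact h5
  calc _ ≤ (∑ n ∈ Finset.Icc 1 N, ‖∑ i ∈ I, v i N n‖) ^ 2 := by gcongr
    _ ≤ _ := h2
    _ ≤ N * (D * N + ε * N) := by gcongr
    _ = _ := by ring

lemma quasi_periodic_bound (G : ℕ → ℂ) (hG : ∀ n, ‖G n‖ ≤ 1) (Q : ℕ) (ζ : ℂ) (hζ : ζ ≠ 1)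
    (h : ∀ n, G (n + Q) = ζ * G n) :
    (fun N : ℕ => ∑ n ∈ Finset.Icc 1 N, G n) =o[atTop] (fun N : ℕ => (N : ℝ)) := by
  have hz : 0 < ‖ζ - 1‖ := by simpa [sub_eq_zero] using hζ
  have key : ∀ N : ℕ, ‖∑ n ∈ Finset.Icc 1 N, G n‖ ≤ 2 * Q / ‖ζ - 1‖ := by
    intro N
    rw [le_div_iff₀ hz, ← norm_mul]
    have e : ∑ n ∈ Finset.Icc 1 N, G (n + Q) + ∑ n ∈ Finset.Icc 1 Q, G n =
      ∑ n ∈ Finset.Icc 1 N, G n + ∑ n ∈ Finset.Icc 1 Q, G (n + N) := by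
      have a1 : ∀ K M : ℕ, ∑ n ∈ Finset.Icc 1 K, G (n + M) + ∑ n ∈ Finset.Icc 1 M, G n
          = ∑ n ∈ Finset.Icc 1 (K + M), G n := by
        intro K M
        induction K with
        | zero => simp
        | succ K ih =>
          rw [Finset.sum_Icc_succ_top (by omega), show K + 1 + M = K + M + 1 by ring,
            Finset.sum_Icc_succ_top (by omega), ← ih]
          ring
      rw [a1, add_comm N Q, ← a1]; ring
    have : (∑ n ∈ Finset.Icc 1 N, G n) * (ζ - 1) = ∑ n ∈ Finset.Icc 1 Q, G (n + N) - ∑ n ∈ Finset.Icc 1 Q, G n := by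
      simp_rw [h, ← Finset.mul_sum] at e
      linear_combination e
    rw [this]
    refine (norm_sub_le _ _).trans ?_
    have b1 : ‖∑ n ∈ Finset.Icc 1 Q, G (n + N)‖ ≤ Q := by
      refine (norm_sum_le_of_le _ fun n _ => hG _).trans ?_
      simp
    have b2 : ‖∑ n ∈ Finset.Icc 1 Q, G n‖ ≤ Q := by
      refine (norm_sum_le_of_le _ fun n _ => hG _).trans ?_
      simp
    linarith
  have h1 : (fun N : ℕ => ∑ n ∈ Finset.Icc 1 N, G n) =O[atTop] (fun _ : ℕ => (1 : ℝ)) := by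
    apply Asymptotics.IsBigO.of_bound (2 * Q / ‖ζ - 1‖)
    filter_upwards with N
    simpa using key N
  refine h1.trans_isLittleO ?_
  rw [Asymptotics.isLittleO_const_left]
  right
  simpa [Function.comp_def] using tendsto_natCast_atTop_atTop (R := ℝ)

lemma vdc (u : ℕ → ℂ) (hu : ∀ n, ‖u n‖ ≤ 1)
    (h : ∀ a b : ℕ, a ≠ b → (fun N : ℕ => ∑ n ∈ Finset.Icc 1 N, u (n + a) * (starRingEnd ℂ) (u (n + b)))
      =o[atTop] (fun N : ℕ => (N : ℝ))) :
    (fun N : ℕ => ∑ n ∈ Finset.Icc 1 N, u n) =o[atTop] (fun N : ℕ => (N : ℝ)) := by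
  rw [Asymptotics.isLittleO_iff]
  intro ε hε
  -- choose H
  obtain ⟨H, hH⟩ := exists_nat_gt (8 / ε ^ 2 + 1)
  have hH0 : (0:ℝ) < H := by
    have : 0 < 8 / ε ^ 2 := by positivity
    linarith
  have hcs := gen_CS (Finset.range H) (fun i _ n => u (n + i)) (fun _ => 1) H (by simp)
    (by intro i _ j _ hij; exact h i j hij)
    (by
      intro N
      calc _ ≤ ∑ i ∈ Finset.range H, ∑ n ∈ Finset.Icc 1 N, (1:ℝ) := by
            gcongr with i _ n _
            exact pow_le_one₀ (norm_nonneg _) (hu _)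
        _ = _ := by simp) H hH0
  have hN2 : ∀ᶠ N : ℕ in atTop, (4 * H / ε : ℝ) ≤ N :=
    tendsto_natCast_atTop_atTop.eventually_ge_atTop _
  filter_upwards [hcs, hN2] with N h1 h2
  have shift : ∀ i : ℕ, ‖∑ n ∈ Finset.Icc 1 N, u (n + i) - ∑ n ∈ Finset.Icc 1 N, u n‖ ≤ 2 * i := by
    intro i
    induction i with
    | zero => simp
    | succ i ih =>
      have e : ∑ n ∈ Finset.Icc 1 N, u (n + (i+1)) - ∑ n ∈ Finset.Icc 1 N, u (n + i) = u (N + (i+1)) - u (i + 1) := by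
        clear h1 h2 ih
        induction N with
        | zero => simp
        | succ N ihN =>
          rw [Finset.sum_Icc_succ_top (by omega), Finset.sum_Icc_succ_top (by omega)]
          have : N + 1 + i = N + (i + 1) := by ring
          rw [this]
          linear_combination ihN
      have : ‖u (N + (i+1)) - u (i + 1)‖ ≤ 2 := (norm_sub_le _ _).trans (by linarith [hu (N + (i+1)), hu (i+1)])
      calc _ = ‖(u (N + (i+1)) - u (i + 1)) + (∑ n ∈ Finset.Icc 1 N, u (n + i) - ∑ n ∈ Finset.Icc 1 N, u n)‖ := by
            rw [← e, sub_add_sub_cancel]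
        _ ≤ _ := norm_add_le _ _
        _ ≤ _ := by push_cast; linarith
  set S := ∑ n ∈ Finset.Icc 1 N, u n with hS
  have tot : ‖∑ n ∈ Finset.Icc 1 N, (1:ℂ) * ∑ i ∈ Finset.range H, u (n + i) - H * S‖ ≤ 2 * H * H := by
    have : ∑ n ∈ Finset.Icc 1 N, (1:ℂ) * ∑ i ∈ Finset.range H, u (n + i) - H * S =
        ∑ i ∈ Finset.range H, (∑ n ∈ Finset.Icc 1 N, u (n + i) - S) := by
      rw [Finset.sum_sub_distrib]
      simp only [one_mul, Finset.sum_const, Finset.card_range, nsmul_eq_mul]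
      rw [Finset.sum_comm]
    rw [this]
    refine (norm_sum_le_of_le (n := fun _ => (2 * H : ℝ)) _ fun i hi => (shift i).trans ?_).trans ?_
    · have : (i:ℝ) ≤ H := by exact_mod_cast (Finset.mem_range.mp hi).le
      linarith
    · simp; linarith
  have h5 : ‖∑ n ∈ Finset.Icc 1 N, (1:ℂ) * ∑ i ∈ Finset.range H, u (n + i)‖ ≤ (ε/2 * H) * N := by
    apply le_of_sq_le_sq _ (by positivity)
    refine h1.trans ?_
    have : (H:ℝ) + H ≤ (ε/2*H)^2 := by
      have : 8 / ε^2 ≤ H := by linarith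
      rw [div_le_iff₀ (by positivity)] at this
      nlinarith
    calc _ ≤ (N:ℝ)^2 * (ε/2*H)^2 := by gcongr
      _ = _ := by ring
  have h6 : ‖(H:ℂ) * S‖ ≤ (ε/2 * H) * N + 2 * H * H := by
    have := norm_sub_norm_le ((H:ℂ) * S) (∑ n ∈ Finset.Icc 1 N, (1:ℂ) * ∑ i ∈ Finset.range H, u (n + i))
    rw [norm_sub_rev] at this
    linarith
  rw [norm_mul, Complex.norm_natCast] at h6
  rw [div_le_iff₀ hε] at h2
  have h7 : (H:ℝ) * ‖S‖ ≤ H * (ε * N) := by nlinarith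
  simpa using le_of_mul_le_mul_left h7 hH0


lemma card_mult (N p : ℕ) (hp : 0 < p) : ((Finset.Icc 1 N).filter (p ∣ ·)).card = N / p := by
  rw [← Nat.Ioc_filter_dvd_card_eq_div N p]
  congr 1

lemma sum_mult (N p : ℕ) (hp : 0 < p) (f : ℕ → ℂ) :
    ∑ n ∈ (Finset.Icc 1 N).filter (p ∣ ·), f n = ∑ m ∈ Finset.Icc 1 (N / p), f (p * m) := by
  symm
  refine Finset.sum_bij (fun m _ => p * m) ?_ ?_ ?_ ?_
  · intro m hm
    simp only [Finset.mem_Icc, Finset.mem_filter, dvd_mul_right, and_true] at hm ⊢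
    rw [Nat.le_div_iff_mul_le hp] at hm
    exact ⟨Nat.mul_pos hp hm.1, by linarith [hm.2, mul_comm p m]⟩
  · intro a _ b _ hab
    exact Nat.eq_of_mul_eq_mul_left hp hab
  · intro n hn
    simp only [Finset.mem_Icc, Finset.mem_filter] at hn
    obtain ⟨⟨h1, h2⟩, m, rfl⟩ := hn
    refine ⟨m, ?_, rfl⟩
    simp only [Finset.mem_Icc]
    rw [Nat.le_div_iff_mul_le hp]
    exact ⟨Nat.pos_of_mul_pos_left h1, by linarith [mul_comm p m]⟩
  · intros; rfl

/-- number of primes from P dividing n -/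
def omP (P : Finset ℕ) (n : ℕ) : ℝ := ∑ p ∈ P, if p ∣ n then (1:ℝ) else 0

lemma sum_ite_dvd (N p : ℕ) (hp : 0 < p) :
    ∑ n ∈ Finset.Icc 1 N, (if p ∣ n then (1:ℝ) else 0) = ((N / p : ℕ) : ℝ) := by
  rw [← card_mult N p hp]
  simp

lemma turan_kubilius (P : Finset ℕ) (hP : ∀ p ∈ P, p.Prime) (N : ℕ) :
    ∑ n ∈ Finset.Icc 1 N, (omP P n - ∑ p ∈ P, (1 / p : ℝ)) ^ 2 ≤
      N * (∑ p ∈ P, (1 / p : ℝ)) + 2 * (∑ p ∈ P, (1 / p : ℝ)) * P.card := by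
  set W := ∑ p ∈ P, (1 / p : ℝ) with hW
  have hW0 : 0 ≤ W := by positivity
  have e : ∑ n ∈ Finset.Icc 1 N, (omP P n - W) ^ 2 =
    ∑ n ∈ Finset.Icc 1 N, (omP P n)^2 - 2 * W * ∑ n ∈ Finset.Icc 1 N, omP P n + N * W ^ 2 := by
    rw [Finset.mul_sum, ← Finset.sum_sub_distrib]
    have : (N * W^2 : ℝ) = ∑ n ∈ Finset.Icc 1 N, W^2 := by simp
    rw [this, ← Finset.sum_add_distrib]
    refine Finset.sum_congr rfl fun n _ => by ring
  have h1 : N * W - P.card ≤ ∑ n ∈ Finset.Icc 1 N, omP P n := by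
    unfold omP
    rw [Finset.sum_comm]
    calc N * W - P.card = ∑ p ∈ P, (N * (1 / p : ℝ) - 1) := by
          rw [Finset.sum_sub_distrib, ← Finset.mul_sum]; simp [hW]
      _ ≤ _ := by
          refine Finset.sum_le_sum fun p hp => ?_
          rw [sum_ite_dvd N p (hP p hp).pos]
          have := Nat.lt_floor_add_one ((N:ℝ) / p)
          rw [Nat.floor_div_eq_div] at this
          rw [mul_one_div]; linarith
  have h2 : ∑ n ∈ Finset.Icc 1 N, (omP P n)^2 ≤ N * W ^ 2 + N * W := by
    have : ∀ n, (omP P n)^2 = ∑ p ∈ P, ∑ q ∈ P, (if p ∣ n then (1:ℝ) else 0) * (if q ∣ n then (1:ℝ) else 0) := by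
      intro n; unfold omP; rw [sq, Finset.sum_mul_sum]
    simp_rw [this]
    rw [Finset.sum_comm]
    have hc : ∀ p ∈ P, ∀ q ∈ P, ∑ n ∈ Finset.Icc 1 N, (if p ∣ n then (1:ℝ) else 0) * (if q ∣ n then (1:ℝ) else 0)
        ≤ N * (1 / p) * (1/q) + (if p = q then (N * (1 / p) : ℝ) else 0) := by
      intro p hp q hq
      by_cases hpq : p = q
      · subst hpq
        simp only [mul_ite, mul_one, mul_zero, if_true, ite_self]
        have : ∀ n, (if p ∣ n then (if p ∣ n then (1:ℝ) else 0) else 0) = if p ∣ n then (1:ℝ) else 0 := by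
          intro n; split_ifs <;> rfl
        simp_rw [this]
        rw [sum_ite_dvd N p (hP p hp).pos]
        have h0 : (0:ℝ) ≤ N * (1 / p) * (1/p) := by positivity
        have := Nat.cast_div_le (α := ℝ) (m := N) (n := p)
        have e2 : (N:ℝ) * (1 / p) = N / p := mul_one_div _ _
        linarith
      · simp only [hpq, if_false, add_zero]
        have hco : Nat.Coprime p q := (Nat.coprime_primes (hP p hp) (hP q hq)).mpr hpq
        have : ∀ n, (if p ∣ n then (1:ℝ) else 0) * (if q ∣ n then (1:ℝ) else 0) = if p * q ∣ n then (1:ℝ) else 0 := by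
          intro n
          have : p * q ∣ n ↔ p ∣ n ∧ q ∣ n :=
            ⟨fun h => ⟨(Dvd.intro _ rfl).trans h, (Dvd.intro_left _ rfl).trans h⟩, fun h => hco.mul_dvd_of_dvd_of_dvd h.1 h.2⟩
          by_cases a : p ∣ n <;> by_cases b : q ∣ n <;> simp [this, a, b]
        simp_rw [this]
        rw [sum_ite_dvd N (p*q) (Nat.mul_pos (hP p hp).pos (hP q hq).pos)]
        have := Nat.cast_div_le (α := ℝ) (m := N) (n := p*q)
        refine this.trans (le_of_eq ?_)
        push_cast; field_simp
    calc _ ≤ ∑ p ∈ P, ∑ q ∈ P, (N * (1 / p) * (1/q) + (if p = q then (N * (1 / p) : ℝ) else 0)) := by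
          refine Finset.sum_le_sum fun p hp => ?_
          rw [Finset.sum_comm]
          exact Finset.sum_le_sum fun q hq => hc p hp q hq
      _ = _ := by
          simp_rw [Finset.sum_add_distrib, ← Finset.mul_sum]
          simp only [Finset.sum_ite_eq]
          rw [← Finset.sum_mul, ← Finset.mul_sum, ← hW]
          rw [Finset.sum_congr (s₁ := P) (f := fun x => if x ∈ P then (N * (1 / x) : ℝ) else 0) rfl (g := fun p => (N * (1/p) : ℝ)) (fun p hp => by simp [hp]), ← Finset.mul_sum, ← hW]
          ring
  rw [e]
  nlinarith

lemma sum_inv_sq_le (P : Finset ℕ) (hP : ∀ p ∈ P, p.Prime) : ∑ p ∈ P, (1 / (p:ℝ)^2) ≤ 2 := by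
  have hs : HasSum (fun n : ℕ => 1 / (n:ℝ)^2) (Real.pi^2/6) := hasSum_zeta_two
  have h1 := sum_le_hasSum P (fun n _ => by positivity) hs
  have := Real.pi_lt_d2
  have := Real.pi_pos
  nlinarith

lemma exists_primes_sum (K : ℝ) : ∃ P : Finset ℕ, (∀ p ∈ P, p.Prime) ∧ K ≤ ∑ p ∈ P, (1 / p : ℝ) := by
  by_contra! hcon
  apply Nat.Primes.not_summable_one_div
  apply summable_of_sum_le (c := K)
  · intro p; positivity
  · intro u
    have h2 := hcon (u.map ⟨fun p : Nat.Primes => (p : ℕ), Nat.Primes.coe_nat_injective⟩) (by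
      intro p hp
      obtain ⟨q, _, rfl⟩ := Finset.mem_map.mp hp
      exact q.2)
    rw [Finset.sum_map] at h2
    exact h2.le


lemma norm_mob_le (n : ℕ) : ‖((ArithmeticFunction.moebius n : ℤ) : ℂ)‖ ≤ 1 := by
  rw [Complex.norm_intCast]
  exact_mod_cast ArithmeticFunction.abs_moebius_le_one

lemma mob_prime_mul (p m : ℕ) (hp : p.Prime) :
    ‖((ArithmeticFunction.moebius (p * m) : ℤ) : ℂ) + ((ArithmeticFunction.moebius m : ℤ) : ℂ)‖ ≤
      if p ∣ m then 1 else 0 := by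
  split_ifs with h
  · have : ArithmeticFunction.moebius (p * m) = 0 := by
      apply ArithmeticFunction.moebius_eq_zero_of_not_squarefree
      intro hs
      obtain ⟨k, rfl⟩ := h
      have := hs p ⟨k, by ring⟩
      exact hp.one_lt.ne' (Nat.isUnit_iff.mp this)
    rw [this]
    simpa using norm_mob_le m
  · have hc : Nat.Coprime p m := (Nat.Prime.coprime_iff_not_dvd hp).mpr h
    rw [ArithmeticFunction.isMultiplicative_moebius.map_mul_of_coprime hc,
      ArithmeticFunction.moebius_apply_prime hp]
    simp

theorem katai (F : ℕ → ℂ) (hF : ∀ n, ‖F n‖ ≤ 1)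
    (h : ∀ p q : ℕ, p.Prime → q.Prime → p ≠ q →
      (fun N : ℕ => ∑ n ∈ Finset.Icc 1 N, F (p * n) * (starRingEnd ℂ) (F (q * n)))
        =o[atTop] (fun N : ℕ => (N : ℝ))) :
    (fun N : ℕ => ∑ n ∈ Finset.Icc 1 N, ((ArithmeticFunction.moebius n : ℤ) : ℂ) * F n)
      =o[atTop] (fun N : ℕ => (N : ℝ)) := by
  rw [Asymptotics.isLittleO_iff]
  intro ε hε
  obtain ⟨P, hP, hK⟩ := exists_primes_sum (3 + (6 / ε) ^ 2)
  set W := ∑ p ∈ P, (1 / p : ℝ) with hW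
  have hW1 : 3 ≤ W := by nlinarith [sq_nonneg (6/ε)]
  have hcs := gen_CS P (fun p N m => if p * m ≤ N then F (p * m) else 0)
    (fun n => ((ArithmeticFunction.moebius n : ℤ) : ℂ)) W norm_mob_le ?_ ?_ 1 one_pos
  rotate_left
  · intro p hp q hq hpq
    have hpp := (hP p hp).pos
    have hmax : 0 < max p q := lt_of_lt_of_le hpp (le_max_left _ _)
    have e : (fun N : ℕ => ∑ n ∈ Finset.Icc 1 N, (if p * n ≤ N then F (p * n) else 0) *
        (starRingEnd ℂ) (if q * n ≤ N then F (q * n) else 0)) =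
        (fun N : ℕ => ∑ n ∈ Finset.Icc 1 N, F (p * n) * (starRingEnd ℂ) (F (q * n))) ∘ (fun N => N / max p q) := by
      funext N
      simp only [Function.comp]
      have : Finset.Icc 1 (N / max p q) = (Finset.Icc 1 N).filter (fun n => p * n ≤ N ∧ q * n ≤ N) := by
        ext n
        simp only [Finset.mem_Icc, Finset.mem_filter]
        rw [Nat.le_div_iff_mul_le hmax, ← Nat.mul_max_mul_left, max_le_iff, mul_comm n p, mul_comm n q]
        constructor
        · rintro ⟨a, b, c⟩
          exact ⟨⟨a, (Nat.le_mul_of_pos_left n hpp).trans b⟩, b, c⟩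
        · rintro ⟨⟨a, _⟩, b, c⟩
          exact ⟨a, b, c⟩
      rw [this, Finset.sum_filter]
      refine Finset.sum_congr rfl fun n _ => ?_
      by_cases a : p * n ≤ N <;> by_cases b : q * n ≤ N <;> simp [a, b]
    rw [e]
    refine ((h p q (hP p hp) (hP q hq) hpq).comp_tendsto (Nat.tendsto_div_const_atTop hmax.ne')).trans_isBigO ?_
    apply Asymptotics.IsBigO.of_bound 1
    filter_upwards with N
    simp only [Function.comp, Real.norm_natCast, one_mul]
    exact_mod_cast Nat.div_le_self _ _
  · intro N
    rw [hW, Finset.sum_mul]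
    refine Finset.sum_le_sum fun p hp => ?_
    have hpp := (hP p hp).pos
    calc _ ≤ ∑ n ∈ Finset.Icc 1 N, (if p * n ≤ N then (1:ℝ) else 0) := by
          refine Finset.sum_le_sum fun n _ => ?_
          split_ifs
          · exact pow_le_one₀ (norm_nonneg _) (hF _)
          · simp
      _ = (N / p : ℕ) := by
          rw [← Finset.sum_filter]
          have : (Finset.Icc 1 N).filter (fun n => p * n ≤ N) = Finset.Icc 1 (N / p) := by
            ext n
            simp only [Finset.mem_Icc, Finset.mem_filter]
            rw [Nat.le_div_iff_mul_le hpp, mul_comm n p]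
            constructor
            · rintro ⟨⟨a, _⟩, b⟩; exact ⟨a, b⟩
            · rintro ⟨a, b⟩; exact ⟨⟨a, (Nat.le_mul_of_pos_left n hpp).trans b⟩, b⟩
          rw [this]; simp
      _ ≤ _ := by
          refine Nat.cast_div_le.trans (le_of_eq ?_)
          ring
  have hN2 : ∀ᶠ N : ℕ in atTop, (2 * W * P.card : ℝ) ≤ N :=
    tendsto_natCast_atTop_atTop.eventually_ge_atTop _
  filter_upwards [hcs, hN2] with N h1 h2
  set S := ∑ n ∈ Finset.Icc 1 N, ((ArithmeticFunction.moebius n : ℤ) : ℂ) * F n with hS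
  have hsq : (Real.sqrt (W+1))^2 = W + 1 := Real.sq_sqrt (by linarith)
  -- step B
  have hB : ‖(∑ n ∈ Finset.Icc 1 N, ((ArithmeticFunction.moebius n : ℤ) : ℂ) * F n * (omP P n : ℂ)) - W * S‖
      ≤ N * Real.sqrt (W + 1) := by
    have e1 : (∑ n ∈ Finset.Icc 1 N, ((ArithmeticFunction.moebius n : ℤ) : ℂ) * F n * (omP P n : ℂ)) - W * S
        = ∑ n ∈ Finset.Icc 1 N, ((ArithmeticFunction.moebius n : ℤ) : ℂ) * F n * ((omP P n - W : ℝ) : ℂ) := by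
      rw [hS, Finset.mul_sum, ← Finset.sum_sub_distrib]
      refine Finset.sum_congr rfl fun n _ => ?_
      push_cast; ring
    have e2 : ‖∑ n ∈ Finset.Icc 1 N, ((ArithmeticFunction.moebius n : ℤ) : ℂ) * F n * ((omP P n - W : ℝ) : ℂ)‖
        ≤ ∑ n ∈ Finset.Icc 1 N, |omP P n - W| := by
      refine norm_sum_le_of_le _ fun n _ => ?_
      rw [norm_mul, norm_mul, Complex.norm_real, Real.norm_eq_abs]
      refine mul_le_of_le_one_left (abs_nonneg _) ?_
      exact mul_le_one₀ (norm_mob_le n) (norm_nonneg _) (hF n)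
    have e3 : (∑ n ∈ Finset.Icc 1 N, |omP P n - W|)^2 ≤ N * ∑ n ∈ Finset.Icc 1 N, (omP P n - W)^2 := by
      have := sq_sum_le_card_mul_sum_sq (s := Finset.Icc 1 N) (f := fun n => |omP P n - W|)
      simpa using this
    rw [e1]
    refine e2.trans ?_
    apply le_of_sq_le_sq _ (by positivity)
    refine e3.trans ?_
    have := turan_kubilius P hP N
    rw [mul_pow, hsq]
    have : ∑ n ∈ Finset.Icc 1 N, (omP P n - W)^2 ≤ N * (W + 1) := by linarith
    calc _ ≤ (N:ℝ) * (N * (W + 1)) := by gcongr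
      _ = _ := by ring
  -- step C, D, E
  have hC : (∑ n ∈ Finset.Icc 1 N, ((ArithmeticFunction.moebius n : ℤ) : ℂ) * F n * (omP P n : ℂ)) =
      ∑ p ∈ P, ∑ m ∈ Finset.Icc 1 (N / p), ((ArithmeticFunction.moebius (p * m) : ℤ) : ℂ) * F (p * m) := by
    have : ∀ n, ((ArithmeticFunction.moebius n : ℤ) : ℂ) * F n * (omP P n : ℂ) =
        ∑ p ∈ P, if p ∣ n then ((ArithmeticFunction.moebius n : ℤ) : ℂ) * F n else 0 := by
      intro n; unfold omP; push_cast; rw [Finset.mul_sum]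
      refine Finset.sum_congr rfl fun p _ => by split_ifs <;> simp
    simp_rw [this]
    rw [Finset.sum_comm]
    refine Finset.sum_congr rfl fun p hp => ?_
    rw [← Finset.sum_filter, sum_mult N p (hP p hp).pos]
  have hE : ∑ n ∈ Finset.Icc 1 N, ((ArithmeticFunction.moebius n : ℤ) : ℂ) *
      ∑ p ∈ P, (if p * n ≤ N then F (p * n) else 0) =
      ∑ p ∈ P, ∑ m ∈ Finset.Icc 1 (N / p), ((ArithmeticFunction.moebius m : ℤ) : ℂ) * F (p * m) := by
    simp_rw [Finset.mul_sum]
    rw [Finset.sum_comm]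
    refine Finset.sum_congr rfl fun p hp => ?_
    have hpp := (hP p hp).pos
    have : Finset.Icc 1 (N / p) = (Finset.Icc 1 N).filter (fun n => p * n ≤ N) := by
      ext n
      simp only [Finset.mem_Icc, Finset.mem_filter]
      rw [Nat.le_div_iff_mul_le hpp, mul_comm n p]
      constructor
      · rintro ⟨a, b⟩; exact ⟨⟨a, (Nat.le_mul_of_pos_left n hpp).trans b⟩, b⟩
      · rintro ⟨⟨a, _⟩, b⟩; exact ⟨a, b⟩
    rw [this, Finset.sum_filter]
    refine Finset.sum_congr rfl fun n _ => by split_ifs <;> simp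
  have hD : ‖(∑ p ∈ P, ∑ m ∈ Finset.Icc 1 (N / p), ((ArithmeticFunction.moebius (p * m) : ℤ) : ℂ) * F (p * m))
      + ∑ p ∈ P, ∑ m ∈ Finset.Icc 1 (N / p), ((ArithmeticFunction.moebius m : ℤ) : ℂ) * F (p * m)‖ ≤ 2 * N := by
    rw [← Finset.sum_add_distrib]
    calc _ ≤ ∑ p ∈ P, ((N : ℝ) * (1 / (p:ℝ)^2) : ℝ) := by
          refine norm_sum_le_of_le _ fun p hp => ?_
          have hpp := (hP p hp).pos
          rw [← Finset.sum_add_distrib]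
          calc _ ≤ ∑ m ∈ Finset.Icc 1 (N / p), (if p ∣ m then (1:ℝ) else 0) := by
                refine norm_sum_le_of_le _ fun m _ => ?_
                rw [← add_mul, norm_mul]
                refine (mul_le_of_le_one_right (norm_nonneg _) (hF _)).trans ?_
                exact mob_prime_mul p m (hP p hp)
            _ = ((N / p / p : ℕ) : ℝ) := sum_ite_dvd _ _ hpp
            _ ≤ _ := by
                rw [Nat.div_div_eq_div_mul]
                refine Nat.cast_div_le.trans (le_of_eq ?_)
                push_cast; ring
      _ = (N:ℝ) * ∑ p ∈ P, (1 / (p:ℝ)^2) := by rw [Finset.mul_sum]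
      _ ≤ (N:ℝ) * 2 := by gcongr; exact sum_inv_sq_le P hP
      _ = _ := by ring
  rw [hE] at h1
  rw [hC] at hB
  set X := ∑ p ∈ P, ∑ m ∈ Finset.Icc 1 (N / p), ((ArithmeticFunction.moebius (p * m) : ℤ) : ℂ) * F (p * m)
  set Y := ∑ p ∈ P, ∑ m ∈ Finset.Icc 1 (N / p), ((ArithmeticFunction.moebius m : ℤ) : ℂ) * F (p * m)
  have hY : ‖Y‖ ≤ N * Real.sqrt (W + 1) := by
    apply le_of_sq_le_sq _ (by positivity)
    rw [mul_pow, hsq]; exact h1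
  have hWS : ‖(W:ℂ) * S‖ ≤ N * (2 * Real.sqrt (W + 1) + 2) := by
    have : (W:ℂ) * S = (X + Y) - Y - (X - W * S) := by ring
    rw [this]
    have a1 := norm_sub_le ((X + Y) - Y) (X - W * S)
    have a2 := norm_sub_le (X + Y) Y
    nlinarith
  rw [norm_mul, Complex.norm_real, Real.norm_of_nonneg (by linarith)] at hWS
  have hfin : 2 * Real.sqrt (W + 1) + 2 ≤ ε * W := by
    have hs0 := Real.sqrt_nonneg (W+1)
    have hs1 : 2 ≤ Real.sqrt (W+1) := by
      apply Real.le_sqrt_of_sq_le; linarith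
    have hsK : 6 / ε ≤ Real.sqrt (W + 1) := by
      apply Real.le_sqrt_of_sq_le; linarith
    rw [div_le_iff₀ hε] at hsK
    have : 3 / 4 * (Real.sqrt (W+1))^2 ≤ W := by nlinarith
    have h8 : ε * (3 / 4 * (Real.sqrt (W+1))^2) ≤ ε * W := by gcongr
    nlinarith
  have h7 : W * ‖S‖ ≤ W * (ε * N) := by
    refine hWS.trans ?_
    calc _ ≤ (N:ℝ) * (ε * W) := by gcongr
      _ = _ := by ring
  simpa using le_of_mul_le_mul_left h7 (by linarith)



open MeasureTheory in
open scoped FourierTransform SchwartzMap in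
lemma exists_kernel : ∃ φ K : ℝ → ℂ, Continuous φ ∧ HasCompactSupport φ ∧ Continuous K ∧
    Integrable K ∧ (∀ u, K u = ∫ y : ℝ, Complex.exp (-(2 * Real.pi * Complex.I * y * u)) * φ y) ∧
    ∫ u, K u = 1 := by
  let b : ContDiffBump (0:ℝ) := ⟨1, 2, by norm_num, by norm_num⟩
  have h1 : HasCompactSupport (fun y => ((b y : ℝ) : ℂ)) := b.hasCompactSupport.comp_left (g := Complex.ofReal) rfl
  have h2 : ContDiff ℝ ((⊤ : ℕ∞) : WithTop ℕ∞) (fun y => ((b y : ℝ) : ℂ)) :=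
    Complex.ofRealCLM.contDiff.comp b.contDiff
  let φ : 𝓢(ℝ, ℂ) := h1.toSchwartzMap h2
  have hφ : ∀ y, φ y = ((b y : ℝ) : ℂ) := fun y => rfl
  refine ⟨φ, (𝓕 φ : 𝓢(ℝ, ℂ)), φ.continuous, h1, (𝓕 φ).continuous, (𝓕 φ).integrable, ?_, ?_⟩
  · intro u
    rw [SchwartzMap.fourier_coe, Real.fourier_eq']
    refine integral_congr_ae (Eventually.of_forall fun y => ?_)
    simp only [smul_eq_mul]
    congr 2
    simp
    ring
  · have h3 : 𝓕⁻ (𝓕 φ) = φ := FourierTransform.fourierInv_fourier_eq φ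
    have h4 : (𝓕⁻ (𝓕 φ)) 0 = φ 0 := by rw [h3]
    rw [SchwartzMap.fourierInv_coe, Real.fourierInv_eq'] at h4
    simp only [inner_zero_right, mul_zero, Complex.ofReal_zero, zero_mul, Complex.exp_zero, one_smul] at h4
    rw [h4, hφ]
    have : b 0 = 1 := b.one_of_mem_closedBall (by simp [b])
    rw [this]; simp

open MeasureTheory in
lemma tauber_A (φ K : ℝ → ℂ) (hφ : Continuous φ) (hφc : HasCompactSupport φ) (hK : Continuous K)
    (hKi : Integrable K) (hKφ : ∀ u, K u = ∫ y : ℝ, Complex.exp (-(2 * Real.pi * Complex.I * y * u)) * φ y)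
    (f : ℝ → ℂ) (hfm : Measurable f) (B : ℝ) (hB : ∀ t, ‖f t‖ ≤ B) 
    (g : ℂ → ℂ) (hg : ContinuousOn g {z | 0 ≤ z.re})
    (hfg : ∀ z : ℂ, 0 < z.re → g z = ∫ t in Set.Ioi (0:ℝ), f t * Complex.exp (-(z * t))) :
    Tendsto (fun T : ℝ => ∫ t in Set.Ioi (0:ℝ), f t * K (t - T)) atTop (nhds 0) := by
  have hB0 : 0 ≤ B := (norm_nonneg _).trans (hB 0)
  have hφi : Integrable φ := hφ.integrable_of_hasCompactSupport hφc
  have step1 : ∀ T σ : ℝ, 0 < σ → ∫ t in Set.Ioi (0:ℝ), (f t * Complex.exp (-(σ * t))) * K (t - T) =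
      ∫ y : ℝ, φ y * Complex.exp (2 * Real.pi * Complex.I * y * T) * g (σ + 2 * Real.pi * Complex.I * y) := by
    intro T σ hσ
    have hint : Integrable (fun t : ℝ => f t * Complex.exp (-(σ * t))) (volume.restrict (Set.Ioi (0:ℝ))) := by
      have h1 : IntegrableOn (fun t : ℝ => B * Real.exp (-σ * t)) (Set.Ioi 0) :=
        (integrableOn_exp_mul_Ioi (neg_lt_zero.mpr hσ) 0).const_mul B
      refine Integrable.mono' h1 (by fun_prop) (Eventually.of_forall fun t => ?_)
      rw [norm_mul, Complex.norm_exp]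
      simp only [Complex.neg_re, Complex.mul_re, Complex.ofReal_re, Complex.ofReal_im, mul_zero, sub_zero, neg_mul]
      gcongr
      exact hB t
    calc _ = ∫ t in Set.Ioi (0:ℝ), ∫ y : ℝ, (f t * Complex.exp (-(σ * t))) * (Complex.exp (-(2 * Real.pi * Complex.I * y * (t - T))) * φ y) := by
          refine integral_congr_ae (Eventually.of_forall fun t => ?_)
          simp only
          rw [hKφ, ← integral_const_mul]
          push_cast; rfl
      _ = ∫ y : ℝ, ∫ t in Set.Ioi (0:ℝ), (f t * Complex.exp (-(σ * t))) * (Complex.exp (-(2 * Real.pi * Complex.I * y * (t - T))) * φ y) := by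
          rw [integral_integral_swap]
          have h2 := hint.mul_prod hφi
          have h3 : AEStronglyMeasurable (fun x : ℝ × ℝ => Complex.exp (-(2 * Real.pi * Complex.I * x.2 * (x.1 - T)))) ((volume.restrict (Set.Ioi (0:ℝ))).prod volume) := by
            fun_prop
          have h4 := h2.bdd_mul h3 (c := 1) (Eventually.of_forall fun x => by
            rw [Complex.norm_exp]
            simp)
          refine h4.congr (Eventually.of_forall fun x => ?_)
          simp only [Function.uncurry]
          ring
      _ = _ := by
          refine integral_congr_ae (Eventually.of_forall fun y => ?_)
          simp only
          rw [hfg _ (by simp [hσ]), ← integral_const_mul]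
          refine integral_congr_ae (Eventually.of_forall fun t => ?_)
          simp only
          have : Complex.exp (-(σ * t)) * Complex.exp (-(2 * Real.pi * Complex.I * y * (t - T))) =
            Complex.exp (2 * Real.pi * Complex.I * y * T) * Complex.exp (-((σ + 2 * Real.pi * Complex.I * y) * t)) := by
            rw [← Complex.exp_add, ← Complex.exp_add]; ring_nf
          linear_combination f t * φ y * this
  have step2 : ∀ T : ℝ, ∫ t in Set.Ioi (0:ℝ), f t * K (t - T) =
      ∫ y : ℝ, φ y * Complex.exp (2 * Real.pi * Complex.I * y * T) * g (2 * Real.pi * Complex.I * y) := by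
    intro T
    have hKT : Integrable (fun t => K (t - T)) := hKi.comp_sub_right T
    have l1 : Tendsto (fun σ : ℝ => ∫ t in Set.Ioi (0:ℝ), (f t * Complex.exp (-(σ * t))) * K (t - T))
        (nhdsWithin 0 (Set.Ioi 0)) (nhds (∫ t in Set.Ioi (0:ℝ), f t * K (t - T))) := by
      apply tendsto_integral_filter_of_dominated_convergence (fun t => B * ‖K (t - T)‖)
      · filter_upwards with σ
        fun_prop
      · filter_upwards [self_mem_nhdsWithin] with σ hσ
        filter_upwards [ae_restrict_mem measurableSet_Ioi] with t ht
        rw [norm_mul, norm_mul, Complex.norm_exp]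
        have h1 : Real.exp (-(σ * t : ℂ)).re ≤ 1 := by
          rw [Real.exp_le_one_iff]
          simp
          exact mul_nonneg (le_of_lt hσ) (le_of_lt ht)
        gcongr
        calc _ ≤ B * 1 := by gcongr; exact hB t
          _ = B := mul_one _
      · exact (hKT.norm.const_mul B).integrableOn
      · filter_upwards with t
        have : Continuous (fun σ : ℝ => f t * Complex.exp (-(σ * t)) * K (t - T)) := by fun_prop
        have h2 := (this.tendsto 0).mono_left (nhdsWithin_le_nhds (s := Set.Ioi 0))
        simpa using h2
    have l2 : Tendsto (fun σ : ℝ => ∫ y : ℝ, φ y * Complex.exp (2 * Real.pi * Complex.I * y * T) * g (σ + 2 * Real.pi * Complex.I * y))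
        (nhdsWithin 0 (Set.Ioi 0)) (nhds (∫ y : ℝ, φ y * Complex.exp (2 * Real.pi * Complex.I * y * T) * g (2 * Real.pi * Complex.I * y))) := by
      -- g bounded
      have hcomp : IsCompact ((fun p : ℝ × ℝ => (p.1 + 2 * Real.pi * Complex.I * p.2 : ℂ)) '' (Set.Icc 0 1 ×ˢ tsupport φ)) :=
        (isCompact_Icc.prod hφc).image (by fun_prop)
      obtain ⟨C, hC⟩ := hcomp.exists_bound_of_continuousOn (f := g) (hg.mono (by
        rintro _ ⟨⟨s, y⟩, ⟨hs, _⟩, rfl⟩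
        simpa using hs.1))
      apply tendsto_integral_filter_of_dominated_convergence (fun y => ‖φ y‖ * C)
      · filter_upwards [self_mem_nhdsWithin] with σ hσ
        have : Continuous (fun y : ℝ => g (σ + 2 * Real.pi * Complex.I * y)) := by
          refine hg.comp_continuous (by fun_prop) ?_
          intro y
          simpa using le_of_lt hσ
        exact ((hφ.mul (by fun_prop)).mul this).aestronglyMeasurable
      · filter_upwards [self_mem_nhdsWithin, mem_nhdsWithin_of_mem_nhds (Iic_mem_nhds one_pos)] with σ hσ hσ1
        filter_upwards with y
        by_cases hy : y ∈ tsupport φ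
        · have := hC (σ + 2 * Real.pi * Complex.I * y) ⟨(σ, y), ⟨⟨le_of_lt hσ, hσ1⟩, hy⟩, rfl⟩
          rw [norm_mul, norm_mul, Complex.norm_exp]
          simp
          gcongr
        · simp [image_eq_zero_of_notMem_tsupport hy]
      · exact hφi.norm.mul_const C
      · filter_upwards with y
        refine Tendsto.const_mul _ ?_
        have hc := hg (2 * Real.pi * Complex.I * y) (by simp)
        refine Tendsto.comp hc (tendsto_nhdsWithin_iff.mpr ⟨?_, ?_⟩)
        · have : Continuous (fun σ : ℝ => (σ + 2 * Real.pi * Complex.I * y : ℂ)) := by fun_prop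
          have h2 := (this.tendsto 0).mono_left (nhdsWithin_le_nhds (s := Set.Ioi 0))
          simpa using h2
        · filter_upwards [self_mem_nhdsWithin] with σ hσ
          simpa using le_of_lt hσ
    refine tendsto_nhds_unique l1 (l2.congr' ?_)
    filter_upwards [self_mem_nhdsWithin] with σ hσ
    exact (step1 T σ hσ).symm
  simp_rw [step2]
  have RL := (Real.zero_at_infty_fourier (fun y : ℝ => φ y * g (2 * Real.pi * Complex.I * y)))
  have RL2 : Tendsto (fun T : ℝ => -T) atTop (cocompact ℝ) :=
    tendsto_neg_atTop_atBot.mono_right atBot_le_cocompact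
  refine (RL.comp RL2).congr fun T => ?_
  simp only [Function.comp]
  rw [Real.fourier_eq']
  refine integral_congr_ae (Eventually.of_forall fun y => ?_)
  simp only [smul_eq_mul]
  have : Complex.exp (((-2 * Real.pi * inner ℝ y (-T) : ℝ) : ℂ) * Complex.I) = Complex.exp (2 * Real.pi * Complex.I * y * T) := by
    congr 1
    simp
    ring
  rw [this]; ring


open MeasureTheory in
theorem tauber (f : ℝ → ℂ) (hfm : Measurable f) (B : ℝ) (hB : ∀ t, ‖f t‖ ≤ B) 
    (g : ℂ → ℂ) (hg : ContinuousOn g {z | 0 ≤ z.re})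
    (hfg : ∀ z : ℂ, 0 < z.re → g z = ∫ t in Set.Ioi (0:ℝ), f t * Complex.exp (-(z * t)))
    (slow : ∀ ε > 0, ∃ δ > 0, ∃ T0 : ℝ, ∀ t s, T0 ≤ t → T0 ≤ s → |t - s| ≤ δ → ‖f t - f s‖ ≤ ε) :
    Tendsto f atTop (nhds 0) := by
  have hB0 : 0 ≤ B := (norm_nonneg _).trans (hB 0)
  obtain ⟨φ, K, hφ, hφc, hK, hKi, hKφ, hK1⟩ := exists_kernel
  set CK := ∫ u, ‖K u‖ with hCK
  have hCK0 : 0 ≤ CK := integral_nonneg fun _ => norm_nonneg _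
  rw [NormedAddGroup.tendsto_nhds_zero]
  intro ε hε
  obtain ⟨δ, hδ, T0, hslow⟩ := slow (ε / (4 * (CK + 1))) (by positivity)
  have htail : Tendsto (fun R : ℝ => ∫ u, ‖K u‖ * (if δ * R < |u| then 1 else 0)) atTop (nhds 0) := by
    have : (0:ℝ) = ∫ u : ℝ, (0:ℝ) := by simp
    rw [this]
    apply tendsto_integral_filter_of_dominated_convergence (fun u => ‖K u‖)
    · filter_upwards with R
      refine (hK.norm.measurable.mul (Measurable.ite ?_ measurable_const measurable_const)).aestronglyMeasurable
      exact measurableSet_lt measurable_const measurable_norm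
    · filter_upwards with R
      filter_upwards with u
      split_ifs <;> simp
    · exact hKi.norm
    · filter_upwards with u
      refine tendsto_const_nhds.congr' ?_
      filter_upwards [eventually_ge_atTop (|u| / δ)] with R hR
      rw [div_le_iff₀ hδ] at hR
      rw [if_neg (by linarith [mul_comm δ R])]; simp
  have htail2 := (htail.eventually (gt_mem_nhds (show (0:ℝ) < ε / (4 * (2 * B + 1)) by positivity))).and (eventually_ge_atTop 1)
  obtain ⟨R, hR, hR1⟩ := htail2.exists
  have hR0 : 0 < R := by linarith
  have hA := tauber_A φ K hφ hφc hK hKi hKφ (fun t => f (t / R)) (by fun_prop) B (fun t => hB _)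
    (fun z => R * g (R * z)) ?_ ?_
  rotate_left
  · refine continuousOn_const.mul (hg.comp (by fun_prop) ?_)
    intro z hz
    simp only [Set.mem_ofPred_eq, Complex.re_ofReal_mul] at hz ⊢
    positivity
  · intro z hz
    rw [hfg (R * z) (by rw [Complex.re_ofReal_mul]; positivity)]
    have := integral_comp_mul_left_Ioi (fun t : ℝ => f (t / R) * Complex.exp (-(z * t))) 0 hR0
    rw [mul_zero] at this
    have e : ∀ t : ℝ, f t * Complex.exp (-(R * z * t)) = f (R * t / R) * Complex.exp (-(z * (R * t : ℝ))) := by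
      intro t
      rw [mul_div_cancel_left₀ _ hR0.ne']
      push_cast; ring_nf
    simp_rw [e, this]
    rw [Complex.real_smul]
    push_cast
    rw [← mul_assoc, mul_inv_cancel₀ (by exact_mod_cast hR0.ne'), one_mul]
  have hA2 := (NormedAddGroup.tendsto_nhds_zero.mp hA) (ε / 4) (by positivity)
  have key : ∀ᶠ T : ℝ in atTop, ‖f (T / R)‖ < ε := by
    filter_upwards [hA2, eventually_ge_atTop (R * (max T0 0 + δ + 1))] with T h1 h2
    have e1 : f (T / R) = ∫ t, f (T / R) * K (t - T) := by
      rw [integral_const_mul, integral_sub_right_eq_self K T, hK1, mul_one]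
    have hKT : Integrable (fun t => K (t - T)) := hKi.comp_sub_right T
    have e2 : ∫ t in Set.Ioi (0:ℝ), f (t / R) * K (t - T) =
        ∫ t, (Set.Ioi (0:ℝ)).indicator (fun t => f (t / R)) t * K (t - T) := by
      rw [← integral_indicator measurableSet_Ioi]
      refine integral_congr_ae (Eventually.of_forall fun t => ?_)
      simp only [Set.indicator_mul_left]
    have hmi : Measurable ((Set.Ioi (0:ℝ)).indicator (fun t => f (t / R))) :=
      Measurable.indicator (by fun_prop) measurableSet_Ioi
    have i2 : Integrable (fun t => (Set.Ioi (0:ℝ)).indicator (fun t => f (t / R)) t * K (t - T)) := by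
      refine hKT.bdd_mul hmi.aestronglyMeasurable (c := B) (Eventually.of_forall fun t => ?_)
      exact (norm_indicator_le_norm_self _ _).trans (hB _)
    have e3 : f (T / R) - ∫ t in Set.Ioi (0:ℝ), f (t / R) * K (t - T) =
        ∫ t, (f (T / R) - (Set.Ioi (0:ℝ)).indicator (fun t => f (t / R)) t) * K (t - T) := by
      rw [e2]
      conv_lhs => rw [e1]
      rw [← integral_sub (hKT.const_mul _) i2]
      simp_rw [sub_mul]
    set η := ε / (4 * (CK + 1)) with hη
    have hη0 : 0 < η := by positivity
    have hTR : max T0 0 + δ + 1 ≤ T / R := by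
      rw [le_div_iff₀ hR0]; linarith [mul_comm R (max T0 0 + δ + 1)]
    have hT0 : T0 ≤ max T0 0 := le_max_left _ _
    have h00 : 0 ≤ max T0 0 := le_max_right _ _
    have b0 : ∀ t, ‖(f (T / R) - (Set.Ioi (0:ℝ)).indicator (fun t => f (t / R)) t) * K (t - T)‖ ≤
        η * ‖K (t - T)‖ + 2 * B * (‖K (t - T)‖ * (if δ * R < |t - T| then 1 else 0)) := by
      intro t
      rw [norm_mul]
      split_ifs with h
      · have : ‖f (T / R) - (Set.Ioi (0:ℝ)).indicator (fun t => f (t / R)) t‖ ≤ 2 * B := by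
          refine (norm_sub_le _ _).trans ?_
          have := (norm_indicator_le_norm_self (s := Set.Ioi (0:ℝ)) (fun t => f (t / R)) t).trans (hB _)
          linarith [hB (T / R)]
        have h3 : 0 ≤ η * ‖K (t - T)‖ := by positivity
        calc _ ≤ 2 * B * ‖K (t - T)‖ := by gcongr
          _ ≤ _ := by rw [mul_one]; linarith
      · push Not at h
        have hd : |T / R - t / R| ≤ δ := by
          rw [← sub_div, abs_div, abs_of_pos hR0, div_le_iff₀ hR0, abs_sub_comm]; exact h
        have hd2 := (abs_le.mp hd).2
        have htR : 0 < t / R := by linarith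
        have ht : 0 < t := by
          have := mul_pos htR hR0
          rwa [div_mul_cancel₀ _ hR0.ne'] at this
        rw [Set.indicator_of_mem (show t ∈ Set.Ioi (0:ℝ) from ht)]
        have := hslow (T / R) (t / R) (by linarith) (by linarith) hd
        simp only [mul_zero, add_zero]
        gcongr
    have hmeas : Integrable (fun u => ‖K u‖ * (if δ * R < |u| then (1:ℝ) else 0)) := by
      refine hKi.norm.mul_bdd (c := 1) ?_ (Eventually.of_forall fun u => by split_ifs <;> simp)
      refine (Measurable.ite ?_ measurable_const measurable_const).aestronglyMeasurable
      exact measurableSet_lt measurable_const measurable_norm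
    have hmeasT : Integrable (fun t => ‖K (t - T)‖ * (if δ * R < |t - T| then (1:ℝ) else 0)) :=
      hmeas.comp_sub_right T
    have b1 : ‖f (T / R) - ∫ t in Set.Ioi (0:ℝ), f (t / R) * K (t - T)‖ ≤
        η * CK + 2 * B * ∫ u, ‖K u‖ * (if δ * R < |u| then 1 else 0) := by
      rw [e3]
      refine (norm_integral_le_of_norm_le ((hKT.norm.const_mul η).add (hmeasT.const_mul (2 * B)))
        (Eventually.of_forall b0)).trans (le_of_eq ?_)
      simp only [Pi.add_apply]
      rw [integral_add (hKT.norm.const_mul η) (hmeasT.const_mul (2 * B)), integral_const_mul, integral_const_mul,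
        integral_sub_right_eq_self (fun u => ‖K u‖) T,
        integral_sub_right_eq_self (fun u => ‖K u‖ * (if δ * R < |u| then (1:ℝ) else 0)) T]
    have c1 : η * CK ≤ ε / 4 := by
      rw [hη, div_mul_eq_mul_div, div_le_div_iff₀ (by positivity) (by positivity)]
      nlinarith
    have c2 : 2 * B * ∫ u, ‖K u‖ * (if δ * R < |u| then 1 else 0) ≤ ε / 4 := by
      calc _ ≤ 2 * B * (ε / (4 * (2 * B + 1))) := by gcongr
        _ ≤ _ := by
          rw [mul_div_assoc', div_le_div_iff₀ (by positivity) (by positivity)]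
          nlinarith
    have := norm_sub_norm_le (f (T / R)) (∫ t in Set.Ioi (0:ℝ), f (t / R) * K (t - T))
    linarith
  have hmul : Tendsto (fun x : ℝ => R * x) atTop atTop := tendsto_id.const_mul_atTop hR0
  filter_upwards [hmul.eventually key] with x hx
  rwa [mul_div_cancel_left₀ _ hR0.ne'] at hx


open MeasureTheory in
theorem tauber_dirichlet (a : ℕ → ℂ) (ha : ∀ n, ‖a n‖ ≤ 1) (h : ℂ → ℂ)
    (hc : ContinuousOn h {s | 1 ≤ s.re}) (hL : ∀ s : ℂ, 1 < s.re → LSeries a s = h s) :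
    (fun N : ℕ => ∑ n ∈ Finset.Icc 1 N, a n) =o[atTop] (fun N : ℕ => (N : ℝ)) := by
  set S : ℕ → ℂ := fun N => ∑ n ∈ Finset.Icc 1 N, a n with hS
  have hS1 : ∀ m n : ℕ, m ≤ n → ‖S n - S m‖ ≤ n - m := by
    intro m n hmn
    induction n, hmn using Nat.le_induction with
    | base => simp
    | succ n hn ih =>
      have : S (n+1) = S n + a (n+1) := Finset.sum_Icc_succ_top (by omega) _
      rw [this, add_sub_right_comm]
      refine (norm_add_le _ _).trans ?_
      push_cast
      linarith [ha (n+1)]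
  have hS0 : ∀ n, ‖S n‖ ≤ n := by
    intro n
    have := hS1 0 n (Nat.zero_le _)
    simpa [hS] using this
  set f : ℝ → ℂ := fun t => S ⌊Real.exp t⌋₊ * Real.exp (-t) with hf
  have hSm : Measurable S := measurable_from_nat
  have hfm : Measurable f := by
    have : Measurable (fun t : ℝ => S ⌊Real.exp t⌋₊) := hSm.comp (Nat.measurable_floor.comp Real.measurable_exp)
    fun_prop
  have hM : ∀ t, ‖S ⌊Real.exp t⌋₊‖ ≤ Real.exp t := fun t =>
    (hS0 _).trans (Nat.floor_le (Real.exp_pos t).le)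
  have hfB : ∀ t, ‖f t‖ ≤ 1 := by
    intro t
    simp only [hf]
    rw [norm_mul, Complex.norm_real, Real.norm_of_nonneg (Real.exp_pos _).le]
    calc _ ≤ Real.exp t * Real.exp (-t) := by gcongr; exact hM t
      _ = 1 := by rw [← Real.exp_add]; simp
  have hlap : ∀ z : ℂ, 0 < z.re → h (z + 1) / (z + 1) = ∫ t in Set.Ioi (0:ℝ), f t * Complex.exp (-(z * t)) := by
    intro z hz
    have hz1 : 1 < (z + 1).re := by simpa using hz
    have hne : z + 1 ≠ 0 := by
      intro h0; rw [h0] at hz1; simp at hz1; linarith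
    have h1 := LSeries_eq_mul_integral' a (r := 1) zero_le_one hz1 (by
      apply Asymptotics.IsBigO.of_bound 1
      filter_upwards with n
      rw [Real.rpow_one, Real.norm_of_nonneg (by positivity)]
      simp only [Real.norm_natCast, one_mul]
      refine (Finset.sum_le_sum fun k _ => ha k).trans ?_
      simp)
    rw [hL _ hz1] at h1
    rw [h1, mul_div_cancel_left₀ _ hne]
    have himg : Real.exp '' Set.Ioi 0 = Set.Ioi 1 := by
      ext x
      constructor
      · rintro ⟨t, ht, rfl⟩
        exact Real.one_lt_exp_iff.mpr ht
      · intro hx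
        have hx : 1 < x := hx
        exact ⟨Real.log x, Real.log_pos hx, Real.exp_log (by linarith)⟩
    rw [← himg, integral_image_eq_integral_abs_deriv_smul measurableSet_Ioi
      (fun t _ => (Real.hasDerivAt_exp t).hasDerivWithinAt) Real.exp_injective.injOn]
    refine integral_congr_ae (Eventually.of_forall fun t => ?_)
    simp only [hf]
    rw [Complex.real_smul, abs_of_pos (Real.exp_pos t)]
    have e1 : ((Real.exp t : ℝ) : ℂ) ^ (-(z + 1 + 1)) = Complex.exp (-(z * t)) * Complex.exp (-t) * Complex.exp (-t) := by
      rw [Complex.cpow_def_of_ne_zero (by exact_mod_cast (Real.exp_pos t).ne'), ← Complex.ofReal_log (Real.exp_pos t).le, Real.log_exp,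
        ← Complex.exp_add, ← Complex.exp_add]
      ring_nf
    have e2 : Complex.exp t * Complex.exp (-t) = 1 := by rw [← Complex.exp_add]; simp
    rw [e1]
    push_cast
    linear_combination (S ⌊Real.exp t⌋₊ * Complex.exp (-(z * t)) * Complex.exp (-t)) * e2
  have hlim := tauber f hfm 1 hfB (fun z => h (z + 1) / (z + 1)) ?_ hlap ?_
  rotate_left
  · refine ContinuousOn.div (hc.comp (by fun_prop) ?_) (by fun_prop) ?_
    · intro z hz
      simpa using hz
    · intro z hz h0
      have h1 : (0:ℝ) ≤ z.re := hz
      have h2 : (z + 1).re = 0 := by rw [h0]; simp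
      simp at h2
      linarith
  · intro ε hε
    have main : ∀ t s : ℝ, s ≤ t → ‖f t - f s‖ ≤ 2 * (t - s) + Real.exp (-t) := by
      intro t s hst
      have e : f t - f s = (S ⌊Real.exp t⌋₊ - S ⌊Real.exp s⌋₊) * Real.exp (-t) +
          S ⌊Real.exp s⌋₊ * ((Real.exp (-t) - Real.exp (-s) : ℝ) : ℂ) := by
        simp only [hf]; push_cast; ring
      have hle : ⌊Real.exp s⌋₊ ≤ ⌊Real.exp t⌋₊ := Nat.floor_le_floor (Real.exp_le_exp.mpr hst)
      have a1 : ‖S ⌊Real.exp t⌋₊ - S ⌊Real.exp s⌋₊‖ ≤ Real.exp t - Real.exp s + 1 := by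
        refine (hS1 _ _ hle).trans ?_
        have := Nat.floor_le (Real.exp_pos t).le
        have := Nat.lt_floor_add_one (Real.exp s)
        linarith
      have a2 : |Real.exp (-t) - Real.exp (-s)| = Real.exp (-s) - Real.exp (-t) := by
        rw [abs_sub_comm, abs_of_nonneg]
        have := Real.exp_le_exp.mpr (neg_le_neg hst)
        linarith
      have a3 : 1 - (t - s) ≤ Real.exp (-(t - s)) := by
        have := Real.add_one_le_exp (-(t - s)); linarith
      have p1 : Real.exp s * Real.exp (-t) = Real.exp (-(t - s)) := by rw [← Real.exp_add]; ring_nf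
      have p2 : Real.exp t * Real.exp (-t) = 1 := by rw [← Real.exp_add]; simp
      have p3 : Real.exp s * Real.exp (-s) = 1 := by rw [← Real.exp_add]; simp
      have b1 : ‖(S ⌊Real.exp t⌋₊ - S ⌊Real.exp s⌋₊) * Real.exp (-t)‖ ≤ (t - s) + Real.exp (-t) := by
        rw [norm_mul, Complex.norm_real, Real.norm_of_nonneg (Real.exp_pos _).le]
        calc _ ≤ (Real.exp t - Real.exp s + 1) * Real.exp (-t) := by gcongr
          _ ≤ _ := by nlinarith
      have b2 : ‖S ⌊Real.exp s⌋₊ * ((Real.exp (-t) - Real.exp (-s) : ℝ) : ℂ)‖ ≤ t - s := by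
        rw [norm_mul, Complex.norm_real, Real.norm_eq_abs, a2]
        have : 0 ≤ Real.exp (-s) - Real.exp (-t) := by rw [← a2]; positivity
        calc _ ≤ Real.exp s * (Real.exp (-s) - Real.exp (-t)) := by gcongr; exact hM s
          _ ≤ _ := by nlinarith
      rw [e]
      refine (norm_add_le _ _).trans ?_
      linarith
    have hT : ∀ t, -Real.log (ε / 2) ≤ t → Real.exp (-t) ≤ ε / 2 := by
      intro t ht
      rw [← Real.le_log_iff_exp_le (by positivity)]; linarith
    refine ⟨ε / 4, by positivity, -Real.log (ε / 2), fun t s ht hs hts => ?_⟩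
    rcases le_total s t with hst | hst
    · have := main t s hst
      have := hT t ht
      have := (abs_le.mp hts).2
      linarith
    · rw [norm_sub_rev]
      have := main s t hst
      have := hT s hs
      have := (abs_le.mp hts).1
      linarith
  have hlogN : Tendsto (fun N : ℕ => Real.log N) atTop atTop :=
    Real.tendsto_log_atTop.comp tendsto_natCast_atTop_atTop
  have h2 := hlim.comp hlogN
  rw [Asymptotics.isLittleO_iff]
  intro c hcpos
  filter_upwards [(NormedAddGroup.tendsto_nhds_zero.mp h2) c hcpos, eventually_gt_atTop 0] with N hN hN0
  have hNR : (0:ℝ) < N := by exact_mod_cast hN0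
  simp only [Function.comp, hf] at hN
  rw [Real.exp_log hNR, Nat.floor_natCast, norm_mul, Complex.norm_real, Real.norm_of_nonneg (Real.exp_pos _).le,
    Real.exp_neg, Real.exp_log hNR, ← div_eq_mul_inv, div_lt_iff₀ hNR] at hN
  rw [Real.norm_natCast]
  exact hN.le

theorem mobius_char (q : ℕ) [NeZero q] (χ : DirichletCharacter ℂ q) :
    (fun N : ℕ => ∑ n ∈ Finset.Icc 1 N, χ n * ((ArithmeticFunction.moebius n : ℤ) : ℂ))
      =o[atTop] (fun N : ℕ => (N : ℝ)) := by
  have hbd : ∀ n : ℕ, ‖χ n * ((ArithmeticFunction.moebius n : ℤ) : ℂ)‖ ≤ 1 := by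
    intro n
    rw [norm_mul, Complex.norm_intCast]
    have h1 := DirichletCharacter.norm_le_one χ n
    have h2 : |((ArithmeticFunction.moebius n : ℤ) : ℝ)| ≤ 1 := by exact_mod_cast ArithmeticFunction.abs_moebius_le_one
    exact mul_le_one₀ h1 (abs_nonneg _) h2
  have hinv : ∀ s : ℂ, 1 < s.re → LSeries (fun n : ℕ => χ n * ((ArithmeticFunction.moebius n : ℤ) : ℂ)) s =
      (DirichletCharacter.LFunction χ s)⁻¹ := by
    intro s hs
    have h1 := DirichletCharacter.LSeries.mul_mu_eq_one χ hs
    rw [DirichletCharacter.LFunction_eq_LSeries χ hs]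
    exact eq_inv_of_mul_eq_one_right h1
  by_cases hχ : χ = 1
  · subst hχ
    refine tauber_dirichlet _ hbd (fun s => (s - 1) / DirichletCharacter.LFunctionTrivChar₁ q s) ?_ ?_
    · refine ContinuousOn.div (by fun_prop) (DirichletCharacter.differentiable_LFunctionTrivChar₁ q).continuous.continuousOn ?_
      intro s hs
      by_cases h1 : s = 1
      · rw [h1]; exact DirichletCharacter.LFunctionTrivChar₁_apply_one_ne_zero q
      · rw [DirichletCharacter.LFunctionTrivChar₁, Function.update_of_ne h1]
        exact mul_ne_zero (sub_ne_zero.mpr h1) (DirichletCharacter.LFunction_ne_zero_of_one_le_re 1 (.inr h1) hs)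
    · intro s hs
      have h1 : s ≠ 1 := by rintro rfl; simp at hs
      rw [hinv s hs, DirichletCharacter.LFunctionTrivChar₁, Function.update_of_ne h1]
      have := sub_ne_zero.mpr h1
      rw [div_mul_eq_div_div, div_self this, one_div]
  · refine tauber_dirichlet _ hbd (fun s => (DirichletCharacter.LFunction χ s)⁻¹) ?_ hinv
    refine ContinuousOn.inv₀ (DirichletCharacter.differentiable_LFunction hχ).continuous.continuousOn ?_
    intro s hs
    exact DirichletCharacter.LFunction_ne_zero_of_one_le_re χ (.inl hχ) hs


lemma mobius_AP_unit (q : ℕ) [NeZero q] (b : ZMod q) (hb : IsUnit b) :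
    (fun N : ℕ => ∑ n ∈ Finset.Icc 1 N, if (n : ZMod q) = b then ((ArithmeticFunction.moebius n : ℤ) : ℂ) else 0)
      =o[atTop] (fun N : ℕ => (N : ℝ)) := by
  have hφ : (q.totient : ℂ) ≠ 0 := by
    exact_mod_cast (Nat.totient_pos.mpr (NeZero.pos q)).ne'
  have e : ∀ N : ℕ, (∑ n ∈ Finset.Icc 1 N, if (n : ZMod q) = b then ((ArithmeticFunction.moebius n : ℤ) : ℂ) else 0) =
      ∑ χ : DirichletCharacter ℂ q, ((q.totient : ℂ)⁻¹ * χ b⁻¹) *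
        ∑ n ∈ Finset.Icc 1 N, χ n * ((ArithmeticFunction.moebius n : ℤ) : ℂ) := by
    intro N
    simp_rw [Finset.mul_sum]
    rw [Finset.sum_comm]
    refine Finset.sum_congr rfl fun n _ => ?_
    have h1 := DirichletCharacter.sum_char_inv_mul_char_eq ℂ hb (n : ZMod q)
    have h2 : ∑ χ : DirichletCharacter ℂ q, ((q.totient : ℂ)⁻¹ * χ b⁻¹) * (χ n * ((ArithmeticFunction.moebius n : ℤ) : ℂ)) =
        (q.totient : ℂ)⁻¹ * ((ArithmeticFunction.moebius n : ℤ) : ℂ) * ∑ χ : DirichletCharacter ℂ q, χ b⁻¹ * χ n := by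
      rw [Finset.mul_sum]
      refine Finset.sum_congr rfl fun χ _ => by ring
    rw [h2, h1]
    by_cases h3 : (n : ZMod q) = b
    · rw [if_pos h3, if_pos h3.symm]; field_simp
    · rw [if_neg h3, if_neg (Ne.symm h3)]; simp
  simp_rw [e]
  apply Asymptotics.IsLittleO.fun_sum
  intro χ _
  exact (mobius_char q χ).const_mul_left _

lemma mobius_AP (q : ℕ) [NeZero q] (b : ZMod q) :
    (fun N : ℕ => ∑ n ∈ Finset.Icc 1 N, if (n : ZMod q) = b then ((ArithmeticFunction.moebius n : ℤ) : ℂ) else 0)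
      =o[atTop] (fun N : ℕ => (N : ℝ)) := by
  classical
  have hq := NeZero.pos q
  set g := Nat.gcd b.val q with hg
  have hg0 : 0 < g := Nat.gcd_pos_of_pos_right _ hq
  have hgq : g ∣ q := Nat.gcd_dvd_right _ _
  have hgb : g ∣ b.val := Nat.gcd_dvd_left _ _
  have hcong : ∀ n : ℕ, (n : ZMod q) = b ↔ n ≡ b.val [MOD q] := by
    intro n
    rw [← ZMod.natCast_eq_natCast_iff, ZMod.natCast_zmod_val]
  have key : ∀ m : ℕ, (if ((g * m : ℕ) : ZMod q) = b then ((ArithmeticFunction.moebius (g * m) : ℤ) : ℂ) else 0) =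
      ∑ c ∈ Finset.univ.filter (fun c : ZMod q => IsUnit c ∧ (g : ZMod q) * c = b),
        ((ArithmeticFunction.moebius g : ℤ) : ℂ) * (if (m : ZMod q) = c then ((ArithmeticFunction.moebius m : ℤ) : ℂ) else 0) := by
    intro m
    rw [Finset.sum_filter]
    have : ∀ c : ZMod q, (if IsUnit c ∧ (g : ZMod q) * c = b then ((ArithmeticFunction.moebius g : ℤ) : ℂ) * (if (m : ZMod q) = c then ((ArithmeticFunction.moebius m : ℤ) : ℂ) else 0) else 0) =
        if (m : ZMod q) = c then (if IsUnit c ∧ (g : ZMod q) * c = b then ((ArithmeticFunction.moebius g : ℤ) : ℂ) * ((ArithmeticFunction.moebius m : ℤ) : ℂ) else 0) else 0 := by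
      intro c; split_ifs <;> simp
    simp_rw [this]
    rw [Finset.sum_ite_eq]
    simp only [Finset.mem_univ, if_true]
    by_cases h1 : ((g * m : ℕ) : ZMod q) = b
    · have h1' : (g : ZMod q) * m = b := by rw [← h1]; push_cast; rfl
      rw [if_pos h1]
      simp only [h1', and_true]
      have hun : IsUnit (m : ZMod q) ↔ Nat.Coprime m q := ZMod.isUnit_iff_coprime m q
      by_cases hmg : Nat.Coprime g m
      · have hmq : Nat.Coprime m q := by
          by_contra hcon
          obtain ⟨p, hp, hpm, hpq⟩ := Nat.Prime.not_coprime_iff_dvd.mp hcon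
          have hpg : ¬ p ∣ g := fun h => hp.one_lt.ne' (Nat.dvd_one.mp (hmg ▸ Nat.dvd_gcd h hpm))
          have hmod := (hcong _).mp h1
          -- p * g ∣ q, p * g ∣ g * m
          have hco : Nat.Coprime p g := (Nat.Prime.coprime_iff_not_dvd hp).mpr hpg
          have d1 : p * g ∣ q := hco.mul_dvd_of_dvd_of_dvd hpq hgq
          have d2 : p * g ∣ g * m := by rw [mul_comm p g]; exact Nat.mul_dvd_mul_left g hpm
          have d3 : p * g ∣ b.val := ((hmod.of_dvd d1).dvd_iff (dvd_refl _)).mp d2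
          have d4 : p * g ∣ g := Nat.dvd_gcd d3 d1
          exact hpg ((Dvd.intro _ rfl).trans d4)
        rw [if_pos (hun.mpr hmq), ArithmeticFunction.isMultiplicative_moebius.map_mul_of_coprime hmg]
        push_cast; rfl
      · have hmq : ¬ Nat.Coprime m q := by
          intro h
          exact hmg ((Nat.Coprime.coprime_dvd_right hgq h).symm)
        rw [if_neg (fun h => hmq (hun.mp h))]
        have : ArithmeticFunction.moebius (g * m) = 0 := by
          apply ArithmeticFunction.moebius_eq_zero_of_not_squarefree
          intro hs
          exact hmg (Nat.coprime_of_squarefree_mul hs)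
        rw [this]; simp
    · have h1' : ¬ (g : ZMod q) * m = b := by
        intro h; apply h1; push_cast; exact h
      simp [h1, h1']
  have e : (fun N : ℕ => ∑ n ∈ Finset.Icc 1 N, if (n : ZMod q) = b then ((ArithmeticFunction.moebius n : ℤ) : ℂ) else 0) =
      (fun N : ℕ => ∑ c ∈ Finset.univ.filter (fun c : ZMod q => IsUnit c ∧ (g : ZMod q) * c = b),
        ((ArithmeticFunction.moebius g : ℤ) : ℂ) * ∑ m ∈ Finset.Icc 1 N, (if (m : ZMod q) = c then ((ArithmeticFunction.moebius m : ℤ) : ℂ) else 0)) ∘ (fun N => N / g) := by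
    funext N
    simp only [Function.comp, Finset.mul_sum]
    rw [Finset.sum_comm]
    simp_rw [← key]
    rw [← sum_mult N g hg0 (fun n => if (n : ZMod q) = b then ((ArithmeticFunction.moebius n : ℤ) : ℂ) else 0), Finset.sum_filter]
    refine Finset.sum_congr rfl fun n _ => ?_
    by_cases h : (n : ZMod q) = b
    · have : g ∣ n := (((hcong n).mp h).of_dvd hgq |>.dvd_iff (dvd_refl _)).mpr hgb
      simp [h, this]
    · simp [h]
  rw [e]
  refine (Asymptotics.IsLittleO.comp_tendsto (g := fun N : ℕ => (N : ℝ)) ?_ (Nat.tendsto_div_const_atTop hg0.ne')).trans_isBigO ?_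
  · apply Asymptotics.IsLittleO.fun_sum
    intro c hc
    exact (mobius_AP_unit q c (Finset.mem_filter.mp hc).2.1).const_mul_left _
  · apply Asymptotics.IsBigO.of_bound 1
    filter_upwards with N
    simp only [Function.comp, Real.norm_natCast, one_mul]
    exact_mod_cast Nat.div_le_self _ _

theorem mobius_periodic (q : ℕ) (hq : 0 < q) (F : ℕ → ℂ) (hF : ∀ n, F (n + q) = F n) :
    (fun N : ℕ => ∑ n ∈ Finset.Icc 1 N, ((ArithmeticFunction.moebius n : ℤ) : ℂ) * F n)
      =o[atTop] (fun N : ℕ => (N : ℝ)) := by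
  haveI : NeZero q := ⟨hq.ne'⟩
  have hval : ∀ n : ℕ, F n = F (n : ZMod q).val := by
    intro n
    rw [ZMod.val_natCast]
    exact (Function.Periodic.map_mod_nat hF n).symm
  have e : ∀ N : ℕ, (∑ n ∈ Finset.Icc 1 N, ((ArithmeticFunction.moebius n : ℤ) : ℂ) * F n) =
      ∑ b : ZMod q, F b.val * ∑ n ∈ Finset.Icc 1 N, (if (n : ZMod q) = b then ((ArithmeticFunction.moebius n : ℤ) : ℂ) else 0) := by
    intro N
    simp_rw [Finset.mul_sum]
    rw [Finset.sum_comm]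
    refine Finset.sum_congr rfl fun n _ => ?_
    simp only [mul_ite, mul_zero]
    rw [Finset.sum_ite_eq, hval n]
    simp [mul_comm]
  simp_rw [e]
  apply Asymptotics.IsLittleO.fun_sum
  intro b _
  exact (mobius_AP q b).const_mul_left _


/-- e(x) = exp(2 pi i x) -/
def ee (x : ℝ) : ℂ := Complex.exp (2 * Real.pi * Complex.I * x)

lemma ee_add (x y : ℝ) : ee (x + y) = ee x * ee y := by
  unfold ee; rw [← Complex.exp_add]; push_cast; ring_nf

lemma ee_norm (x : ℝ) : ‖ee x‖ = 1 := by
  unfold ee; rw [Complex.norm_exp]; simp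

lemma ee_conj (x : ℝ) : (starRingEnd ℂ) (ee x) = ee (-x) := by
  unfold ee; rw [← Complex.exp_conj]; simp [Complex.conj_ofNat]

lemma ee_eq_one_iff (x : ℝ) : ee x = 1 ↔ ∃ n : ℤ, x = n := by
  unfold ee
  rw [Complex.exp_eq_one_iff]
  have h2 : (2 * Real.pi * Complex.I : ℂ) ≠ 0 := Complex.two_pi_I_ne_zero
  constructor
  · rintro ⟨n, hn⟩
    refine ⟨n, ?_⟩
    have : (x : ℂ) = n := by
      apply mul_left_cancel₀ h2; rw [hn]; ring
    exact_mod_cast this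
  · rintro ⟨n, rfl⟩
    exact ⟨n, by push_cast; ring⟩

lemma ee_int (n : ℤ) : ee n = 1 := (ee_eq_one_iff _).mpr ⟨n, rfl⟩

lemma ee_ne_one (x : ℝ) (hx : Irrational x) : ee x ≠ 1 := by
  rw [Ne, ee_eq_one_iff]
  rintro ⟨n, rfl⟩
  exact n.not_irrational hx

/-- quadratic phase -/
def qp (α β : ℝ) (n : ℕ) : ℂ := ee (α * n ^ 2 + β * n)

lemma qp_rat_shift (r : ℚ) (β : ℝ) (n : ℕ) : qp r β (n + r.den) = ee (β * r.den) * qp r β n := by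
  unfold qp
  have h1 : (r : ℝ) * r.den = r.num := by exact_mod_cast r.mul_den_eq_num
  have h : (r : ℝ) * ((n + r.den : ℕ) : ℝ) ^ 2 + β * ((n + r.den : ℕ) : ℝ) =
      ((r.num * (2 * n + r.den) : ℤ) : ℝ) + (β * r.den + (r * n ^ 2 + β * n)) := by
    push_cast
    linear_combination (2 * n + r.den : ℝ) * h1
  rw [h, ee_add, ee_int, one_mul, ee_add]

lemma weyl (α β : ℝ) (h : Irrational α ∨ Irrational β) :
    (fun N : ℕ => ∑ n ∈ Finset.Icc 1 N, qp α β n) =o[atTop] (fun N : ℕ => (N : ℝ)) := by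
  by_cases hα : Irrational α
  · apply vdc (qp α β) (fun n => (ee_norm _).le)
    intro a b hab
    refine quasi_periodic_bound _ ?_ 1 (ee (α * (2 * ((a : ℤ) - b : ℤ) : ℤ))) ?_ ?_
    · intro n
      rw [norm_mul, RCLike.norm_conj]; simp [qp, ee_norm]
    · apply ee_ne_one
      apply hα.mul_intCast
      have : (a : ℤ) ≠ b := by exact_mod_cast hab
      omega
    · intro n
      simp only [qp, ee_conj, ← ee_add]
      congr 1
      push_cast; ring
  · have hβ : Irrational β := h.resolve_left hα
    obtain ⟨r, rfl⟩ : ∃ r : ℚ, (r:ℝ) = α := not_not.mp hα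
    refine quasi_periodic_bound _ (fun n => (ee_norm _).le) r.den (ee (β * r.den)) ?_ (qp_rat_shift r β)
    apply ee_ne_one
    exact hβ.mul_natCast r.den_ne_zero

theorem davenport (α β : ℝ) :
    (fun N : ℕ => ∑ n ∈ Finset.Icc 1 N, ((ArithmeticFunction.moebius n : ℤ) : ℂ) * qp α β n)
      =o[atTop] (fun N : ℕ => (N : ℝ)) := by
  by_cases h : Irrational α ∨ Irrational β
  · apply katai (qp α β) (fun n => (ee_norm _).le)
    intro p q hp hq hpq
    have e : ∀ n : ℕ, qp α β (p * n) * (starRingEnd ℂ) (qp α β (q * n)) =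
        qp (α * ((p^2 - q^2 : ℤ) : ℝ)) (β * ((p - q : ℤ) : ℝ)) n := by
      intro n
      simp only [qp, ee_conj, ← ee_add]
      congr 1
      push_cast; ring
    simp_rw [e]
    apply weyl
    have hpq' : (p : ℤ) ≠ q := by exact_mod_cast hpq
    refine h.imp (fun h => h.mul_intCast ?_) (fun h => h.mul_intCast (sub_ne_zero.mpr hpq'))
    intro h0
    have h1 : ((p:ℤ) - q) * (p + q) = 0 := by linear_combination h0
    rcases mul_eq_zero.mp h1 with h2 | h2
    · exact hpq' (sub_eq_zero.mp h2)
    · have := hp.pos; omega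
  · push Not at h
    obtain ⟨r, rfl⟩ : ∃ r : ℚ, (r:ℝ) = α := not_not.mp h.1
    obtain ⟨s, rfl⟩ : ∃ r : ℚ, (r:ℝ) = β := not_not.mp h.2
    apply mobius_periodic (r.den * s.den) (Nat.mul_pos r.den_pos s.den_pos)
    intro n
    have hk : ∀ k : ℕ, qp r s (n + r.den * k) = ee (s * r.den * k) * qp r s n := by
      intro k
      induction k with
      | zero => simp [show ee 0 = 1 by simpa using ee_int 0]
      | succ k ih =>
        rw [mul_add, mul_one, ← add_assoc, qp_rat_shift, ih, ← mul_assoc, ← ee_add]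
        congr 2; push_cast; ring
    rw [hk]
    have h1 : (s : ℝ) * s.den = s.num := by exact_mod_cast s.mul_den_eq_num
    have : (s : ℝ) * r.den * s.den = ((s.num * r.den : ℤ) : ℝ) := by
      push_cast; linear_combination (r.den : ℝ) * h1
    rw [this, ee_int, one_mul]

/-- indicator version -/
theorem davenport_AP (α β : ℝ) (L r : ℕ) (hL : 0 < L) :
    (fun N : ℕ => ∑ n ∈ Finset.Icc 1 N, if n % L = r % L then ((ArithmeticFunction.moebius n : ℤ) : ℂ) * qp α β n else 0)
      =o[atTop] (fun N : ℕ => (N : ℝ)) := by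
  have hL' : (L : ℝ) ≠ 0 := by exact_mod_cast hL.ne'
  have hLc : (L : ℂ) ≠ 0 := by exact_mod_cast hL.ne'
  have orth : ∀ n : ℕ, ∑ j ∈ Finset.range L, ee ((j : ℝ) * ((n:ℝ) - r) / L) = if n % L = r % L then (L:ℂ) else 0 := by
    intro n
    have hp : ∀ j : ℕ, ee ((j : ℝ) * ((n:ℝ) - r) / L) = (ee (((n:ℝ) - r) / L)) ^ j := by
      intro j
      induction j with
      | zero => simp [show ee 0 = 1 by simpa using ee_int 0]
      | succ j ih => rw [pow_succ, ← ih, ← ee_add]; congr 1; push_cast; ring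
    simp_rw [hp]
    have hiff : n % L = r % L ↔ ee (((n:ℝ) - r) / L) = 1 := by
      rw [ee_eq_one_iff]
      have : n % L = r % L ↔ (L:ℤ) ∣ (n:ℤ) - r := by
        rw [show n % L = r % L ↔ r ≡ n [MOD L] from ⟨fun h => h.symm, fun h => h.symm⟩, Nat.modEq_iff_dvd]
      rw [this]
      constructor
      · rintro ⟨k, hk⟩
        refine ⟨k, ?_⟩
        rw [div_eq_iff hL']
        have : ((n:ℤ) - r : ℝ) = (L:ℤ) * k := by exact_mod_cast hk
        push_cast at this; linarith
      · rintro ⟨k, hk⟩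
        refine ⟨k, ?_⟩
        rw [div_eq_iff hL'] at hk
        have : ((n:ℤ) - r : ℝ) = (L:ℤ) * k := by push_cast; linarith
        exact_mod_cast this
    split_ifs with h
    · rw [hiff.mp h]; simp
    · have h1 : ee (((n:ℝ) - r) / L) ≠ 1 := fun h' => h (hiff.mpr h')
      rw [geom_sum_eq h1, ← hp]
      have : (L : ℝ) * ((n:ℝ) - r) / L = ((n - r : ℤ) : ℝ) := by
        rw [mul_div_cancel_left₀ _ hL']; push_cast; rfl
      rw [this, ee_int]; simp
  have e : ∀ N : ℕ, (∑ n ∈ Finset.Icc 1 N, if n % L = r % L then ((ArithmeticFunction.moebius n : ℤ) : ℂ) * qp α β n else 0) =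
      ∑ j ∈ Finset.range L, ((L:ℂ)⁻¹ * ee (-((j:ℝ) * r / L))) *
        ∑ n ∈ Finset.Icc 1 N, ((ArithmeticFunction.moebius n : ℤ) : ℂ) * qp α (β + j / L) n := by
    intro N
    simp_rw [Finset.mul_sum]
    rw [Finset.sum_comm]
    refine Finset.sum_congr rfl fun n _ => ?_
    have h1 : ∀ j : ℕ, (L:ℂ)⁻¹ * ee (-((j:ℝ) * r / L)) * (((ArithmeticFunction.moebius n : ℤ) : ℂ) * qp α (β + j / L) n) =
        (L:ℂ)⁻¹ * (((ArithmeticFunction.moebius n : ℤ) : ℂ) * qp α β n) * ee ((j : ℝ) * ((n:ℝ) - r) / L) := by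
      intro j
      have : ee (-((j:ℝ) * r / L)) * qp α (β + j / L) n = qp α β n * ee ((j : ℝ) * ((n:ℝ) - r) / L) := by
        simp only [qp, ← ee_add]; congr 1; ring
      linear_combination (L:ℂ)⁻¹ * ((ArithmeticFunction.moebius n : ℤ) : ℂ) * this
    simp_rw [h1]
    rw [← Finset.mul_sum, orth n]
    split_ifs
    · field_simp
    · simp
  simp_rw [e]
  apply Asymptotics.IsLittleO.fun_sum
  intro j _
  exact (davenport _ _).const_mul_left _


lemma affine_iter_diff (A : Matrix (Fin 2) (Fin 2) ℤ) (a : Torus 2) (lam : ℝ) (v : Fin 2 → ℝ)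
    (hv : ∀ i, ∑ j, (A i j : ℝ) * v j = lam * v i) (x y : Torus 2) (c : ℝ)
    (h : ∀ i, x i - y i = ((c * v i : ℝ) : AddCircle (1:ℝ))) (j : ℕ) :
    ∀ i, (torusAffine A a)^[j] x i - (torusAffine A a)^[j] y i = ((lam ^ j * c * v i : ℝ) : AddCircle (1:ℝ)) := by
  induction j with
  | zero => simpa using h
  | succ j ih =>
    intro i
    rw [Function.iterate_succ_apply', Function.iterate_succ_apply']
    generalize (torusAffine A a)^[j] x = X at *
    generalize (torusAffine A a)^[j] y = Y at *
    have e : torusAffine A a X i - torusAffine A a Y i = ∑ k, A i k • (X k - Y k) := by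
      simp only [torusAffine, Fin.sum_univ_two, smul_sub]; abel
    rw [e]
    simp_rw [ih]
    rw [show lam ^ (j+1) * c * v i = ∑ k, A i k • (lam ^ j * c * v k) by
      have := hv i
      simp only [Fin.sum_univ_two, zsmul_eq_mul] at this ⊢
      rw [pow_succ]
      linear_combination (- lam ^ j * c) * this]
    simp only [Fin.sum_univ_two, AddCircle.coe_add, AddCircle.coe_zsmul]

lemma exists_scale (L u : ℝ) (hL : 1 < L) (_ : 0 < u) (hu : u ≤ 1/2) (n : ℕ)
    (hn : 1 / (2 * L) ≤ L ^ n * u) : ∃ j ≤ n, 1 / (2*L) ≤ L ^ j * u ∧ L ^ j * u ≤ 1/2 := by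
  classical
  have hex : ∃ j, 1 / (2*L) ≤ L ^ j * u := ⟨n, hn⟩
  refine ⟨Nat.find hex, Nat.find_min' hex hn, Nat.find_spec hex, ?_⟩
  rcases hj : Nat.find hex with _ | k
  · simpa using hu
  · have := Nat.find_min hex (m := k) (by omega)
    push Not at this
    have h2 : L * (L ^ k * u) ≤ L * (1 / (2*L)) := by gcongr
    have h3 : L * (1 / (2*L)) = 1/2 := by field_simp
    rw [h3] at h2
    calc L ^ (k+1) * u = L * (L^k*u) := by ring
      _ ≤ _ := h2

lemma net_lower (A : Matrix (Fin 2) (Fin 2) ℤ) (a : Torus 2) (lam : ℝ) (v : Fin 2 → ℝ)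
    (hv : ∀ i, ∑ j, (A i j : ℝ) * v j = lam * v i) (i : Fin 2) (hvi : v i = 1) (hl : 1 < |lam|) (n : ℕ) :
    ((⌊|lam| ^ n⌋₊ : ℕ) : ℕ∞) ≤ Dynamics.netMaxcard (torusAffine A a) Set.univ
      {p : Torus 2 × Torus 2 | ‖p.1 i - p.2 i‖ < 1 / (4 * |lam|)} (n + 1) := by
  set L := |lam| with hLdef
  have hL0 : 0 < L := by linarith
  set t : ℕ → ℝ := fun k => k * (1 / (2 * L)) / L ^ n with ht
  set P : ℕ → Torus 2 := fun k i => ((t k * v i : ℝ) : AddCircle (1:ℝ)) with hP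
  have key : ∀ k < ⌊L ^ n⌋₊, ∀ l < ⌊L ^ n⌋₊, k ≠ l → ∃ j ≤ n,
      1 / (2 * L) ≤ ‖(torusAffine A a)^[j] (P k) i - (torusAffine A a)^[j] (P l) i‖ := by
    intro k hk l hl hkl
    have hd := affine_iter_diff A a lam v hv (P k) (P l) (t k - t l) (by
      intro i; simp only [hP]; rw [sub_mul]; rfl)
    have hk' : (k:ℝ) ≤ L ^ n := by
      refine le_trans ?_ (Nat.floor_le (by positivity)); exact_mod_cast hk.le
    have hl' : (l:ℝ) ≤ L ^ n := by
      refine le_trans ?_ (Nat.floor_le (by positivity)); exact_mod_cast hl.le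
    have habs : |t k - t l| = |(k:ℝ) - l| * (1 / (2 * L)) / L ^ n := by
      have : t k - t l = ((k:ℝ) - l) * ((1 / (2 * L)) / L ^ n) := by simp only [ht]; ring
      rw [this, abs_mul, abs_of_pos (show 0 < (1 / (2 * L)) / L ^ n by positivity)]; ring
    have h1 : (1:ℝ) ≤ |(k:ℝ) - l| := by
      have : (1:ℤ) ≤ |(k:ℤ) - l| := Int.one_le_abs (sub_ne_zero.mpr (by exact_mod_cast hkl))
      exact_mod_cast this
    have h2 : |(k:ℝ) - l| ≤ L ^ n := by
      rw [abs_le]; constructor <;> linarith [(Nat.cast_nonneg k : (0:ℝ) ≤ k), (Nat.cast_nonneg l : (0:ℝ) ≤ l)]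
    have hLn : 0 < L ^ n := by positivity
    obtain ⟨j, hj, hj1, hj2⟩ := exists_scale L |t k - t l| (by linarith) (by rw [habs]; positivity) (by
        rw [habs, div_le_iff₀ hLn]
        have : 1 / (2 * L) ≤ 1 / 2 := by
          apply one_div_le_one_div_of_le <;> linarith
        calc |(k:ℝ) - l| * (1 / (2 * L)) ≤ L ^ n * (1/2) := by gcongr
          _ = _ := by ring) n (by
        rw [habs]
        calc 1 / (2 * L) = 1 * (1 / (2*L)) := by ring
          _ ≤ |(k:ℝ) - l| * (1 / (2*L)) := by gcongr
          _ = _ := by field_simp)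
    refine ⟨j, hj, ?_⟩
    rw [hd j i, hvi, mul_one]
    have ha : |lam ^ j * (t k - t l)| = L ^ j * |t k - t l| := by rw [abs_mul, abs_pow]
    rw [(AddCircle.norm_coe_eq_abs_iff (1:ℝ) one_ne_zero).mpr (by rw [ha, abs_one]; exact hj2), ha]
    exact hj1
  have hinj : Set.InjOn P (Finset.range ⌊L ^ n⌋₊) := by
    intro k hk l hl h
    by_contra hne
    obtain ⟨j, -, hj⟩ := key k (by simpa using hk) l (by simpa using hl) hne
    rw [h, sub_self, norm_zero] at hj
    have : 0 < 1 / (2 * L) := by positivity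
    linarith
  classical
  have hnet : Dynamics.IsDynNetIn (torusAffine A a) Set.univ
      {p : Torus 2 × Torus 2 | ‖p.1 i - p.2 i‖ < 1 / (4 * L)} (n + 1)
      ((Finset.range ⌊L ^ n⌋₊).image P : Finset (Torus 2)) := by
    refine ⟨Set.subset_univ _, ?_⟩
    intro x hx y hy hxy
    simp only [Finset.coe_image, Set.mem_image, Finset.coe_range, Set.mem_Iio] at hx hy
    obtain ⟨k, hk, rfl⟩ := hx
    obtain ⟨l, hl, rfl⟩ := hy
    obtain ⟨j, hjn, hj⟩ := key k hk l hl (fun h => hxy (by rw [h]))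
    rw [Function.onFun, Set.disjoint_left]
    intro z hz1 hz2
    rw [Dynamics.mem_ball_dynEntourage] at hz1 hz2
    have e1 : ‖(torusAffine A a)^[j] (P k) i - (torusAffine A a)^[j] z i‖ < 1 / (4 * L) := hz1 j (by omega)
    have e2 : ‖(torusAffine A a)^[j] (P l) i - (torusAffine A a)^[j] z i‖ < 1 / (4 * L) := hz2 j (by omega)
    have e3 := norm_sub_le ((torusAffine A a)^[j] (P k) i - (torusAffine A a)^[j] z i)
      ((torusAffine A a)^[j] (P l) i - (torusAffine A a)^[j] z i)
    rw [sub_sub_sub_cancel_right] at e3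
    have : 1 / (4*L) + 1 / (4*L) = 1 / (2*L) := by field_simp; norm_num
    linarith
  have := hnet.card_le_netMaxcard
  rwa [Finset.card_image_of_injOn hinj, Finset.card_range] at this

lemma entropy_pos (A : Matrix (Fin 2) (Fin 2) ℤ) (a : Torus 2) (lam : ℝ) (v : Fin 2 → ℝ)
    (hv : ∀ i, ∑ j, (A i j : ℝ) * v j = lam * v i) (i : Fin 2) (hvi : v i = 1) (hl : 1 < |lam|) :
    0 < Dynamics.coverEntropy (torusAffine A a) Set.univ := by
  set L := |lam| with hLdef
  have hL0 : 0 < L := by linarith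
  set U : SetRel (Torus 2) (Torus 2) := {p : Torus 2 × Torus 2 | ‖p.1 i - p.2 i‖ < 1 / (4 * L)}
  have hU : U ∈ uniformity (Torus 2) := by
    refine Filter.mem_of_superset (Metric.dist_mem_uniformity (show (0:ℝ) < 1 / (4*L) by positivity)) ?_
    intro p hp
    have : dist p.1 p.2 < 1 / (4*L) := hp
    show ‖p.1 i - p.2 i‖ < 1 / (4 * L)
    rw [← dist_eq_norm]
    exact (dist_le_pi_dist p.1 p.2 i).trans_lt this
  refine lt_of_lt_of_le ?_ (Dynamics.netEntropyEntourage_le_coverEntropy _ _ hU)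
  have hlog : 0 < Real.log L / 2 := half_pos (Real.log_pos hl)
  refine lt_of_lt_of_le (b := ((Real.log L / 2 : ℝ) : EReal)) (by exact_mod_cast hlog) ?_
  refine Frequently.le_expGrowthSup (Eventually.frequently ?_)
  set s := Real.exp (Real.log L / 2) with hs
  have hs1 : 1 < s := Real.one_lt_exp_iff.mpr hlog
  have hss : s ^ 2 = L := by
    rw [hs, ← Real.exp_nat_mul]; 
    rw [show ((2:ℕ):ℝ) * (Real.log L / 2) = Real.log L by push_cast; ring, Real.exp_log hL0]
  have ht := (tendsto_pow_atTop_atTop_of_one_lt hs1).eventually_ge_atTop (2 * L)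
  filter_upwards [ht, eventually_ge_atTop 1] with n hn hn1
  obtain ⟨m, rfl⟩ : ∃ m, n = m + 1 := ⟨n - 1, by omega⟩
  have h1 := net_lower A a lam v hv i hvi hl m
  have h2 : ENNReal.ofReal (s ^ (m+1)) ≤ ((⌊L ^ m⌋₊ : ℕ) : ENNReal) := by
    rw [ENNReal.ofReal_le_iff_le_toReal (by simp)]
    simp only [ENNReal.toReal_natCast]
    have h3 := Nat.lt_floor_add_one (L ^ m)
    have h4 : L * L ^ m = s ^ (m+1) * s ^ (m+1) := by
      rw [← pow_succ', ← hss]; ring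
    have h5 : 2 * s ^ (m+1) ≤ L ^ m := by
      have : L * (2 * s ^ (m+1)) ≤ L * L ^ m := by
        rw [h4]
        calc L * (2 * s ^ (m+1)) = (2 * L) * s ^ (m+1) := by ring
          _ ≤ _ := by gcongr
      exact le_of_mul_le_mul_left this hL0
    have h6 : 1 ≤ s ^ (m+1) := one_le_pow₀ hs1.le
    linarith
  have h3 : EReal.exp (((Real.log L / 2 : ℝ) : EReal) * ((m+1 : ℕ) : EReal)) = ENNReal.ofReal (s ^ (m+1)) := by
    rw [show ((m+1 : ℕ) : EReal) = (((m+1 : ℕ) : ℝ) : EReal) by simp, ← EReal.coe_mul, EReal.exp_coe, hs,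
      ← Real.exp_nat_mul]
    congr 2; ring
  rw [h3]
  refine h2.trans ?_
  have := ENat.toENNReal_mono h1
  rw [ENat.toENNReal_coe] at this
  exact this

lemma exists_eigvec (A : Matrix (Fin 2) (Fin 2) ℤ) (lam : ℝ)
    (h : lam ^ 2 - A.trace * lam + A.det = 0) :
    ∃ v : Fin 2 → ℝ, (∀ i, ∑ j, (A i j : ℝ) * v j = lam * v i) ∧ ∃ i, v i = 1 := by
  simp only [Matrix.trace_fin_two, Matrix.det_fin_two] at h
  push_cast at h
  suffices H : ∃ v : Fin 2 → ℝ, (∀ i, ∑ j, (A i j : ℝ) * v j = lam * v i) ∧ ∃ i, v i ≠ 0 by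
    obtain ⟨v, hv, i, hi⟩ := H
    refine ⟨fun k => v k / v i, fun k => ?_, i, div_self hi⟩
    have := hv k
    simp only [Fin.sum_univ_two] at this ⊢
    field_simp
    linarith
  by_cases h1 : (A 0 1 : ℝ) = 0
  · by_cases h2 : lam = A 1 1
    · refine ⟨![0, 1], ?_, 1, by simp⟩
      intro i; fin_cases i <;> simp [Fin.sum_univ_two, h1, h2]
    · have h3 : lam = A 0 0 := by
        have : (lam - A 0 0) * (lam - A 1 1) = 0 := by rw [h1] at h; linear_combination h
        rcases mul_eq_zero.mp this with h4 | h4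
        · linarith
        · exact absurd (by linarith) h2
      refine ⟨![lam - A 1 1, A 1 0], ?_, 0, by simpa [sub_eq_zero] using h2⟩
      intro i; fin_cases i
      · simp [Fin.sum_univ_two, h1]; left; exact h3.symm
      · simp [Fin.sum_univ_two]; ring
  · refine ⟨![A 0 1, lam - A 0 0], ?_, 0, by simpa using h1⟩
    intro i; fin_cases i
    · simp [Fin.sum_univ_two]; ring
    · simp [Fin.sum_univ_two]; linear_combination -h

lemma entropy_zero_cases (A : Matrix (Fin 2) (Fin 2) ℤ) (hA : IsUnit A.det) (a : Torus 2)
    (hEnt : Dynamics.coverEntropy (torusAffine A a) Set.univ = 0) :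
    (A.det = 1 ∧ -2 ≤ A.trace ∧ A.trace ≤ 2) ∨ (A.det = -1 ∧ A.trace = 0) := by
  have noeig : ∀ lam : ℝ, lam ^ 2 - A.trace * lam + A.det = 0 → |lam| ≤ 1 := by
    intro lam h
    by_contra hc
    push Not at hc
    obtain ⟨v, hv, i, hi⟩ := exists_eigvec A lam h
    have := entropy_pos A a lam v hv i hi hc
    rw [hEnt] at this
    exact lt_irrefl _ this
  have two : ∀ D : ℝ, 0 ≤ D → D = (A.trace:ℝ)^2 - 4 * A.det → (|(A.trace : ℝ)| + √D)/2 ≤ 1 := by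
    intro D hD hD'
    have hs : √D ^ 2 = D := Real.sq_sqrt hD
    rcases abs_cases (A.trace : ℝ) with ⟨h1, _⟩ | ⟨h1, _⟩
    · have := noeig ((A.trace + √D)/2) (by linear_combination (1/4 : ℝ) * hs + (1/4:ℝ) * hD')
      rw [h1]; exact (le_abs_self _).trans this
    · have := noeig ((A.trace - √D)/2) (by linear_combination (1/4 : ℝ) * hs + (1/4:ℝ) * hD')
      rw [h1]
      have h3 := neg_abs_le ((A.trace - √D)/2)
      linarith
  rcases Int.isUnit_iff.mp hA with h | h
  · left
    refine ⟨h, ?_⟩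
    rw [← abs_le]
    by_contra hc
    push Not at hc
    have hc' : (3:ℤ) ≤ |A.trace| := hc
    have hc2 : (3:ℝ) ≤ |(A.trace:ℝ)| := by exact_mod_cast hc'
    have := two ((A.trace:ℝ)^2 - 4 * A.det) (by rw [h, ← sq_abs]; push_cast; nlinarith) rfl
    have h3 := Real.sqrt_nonneg ((A.trace:ℝ)^2 - 4 * A.det)
    linarith
  · right
    refine ⟨h, ?_⟩
    by_contra hc
    have hc' : (1:ℤ) ≤ |A.trace| := Int.one_le_abs hc
    have hc2 : (1:ℝ) ≤ |(A.trace:ℝ)| := by exact_mod_cast hc'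
    have := two ((A.trace:ℝ)^2 - 4 * A.det) (by rw [h, ← sq_abs]; push_cast; nlinarith) rfl
    have h3 : 2 ≤ √((A.trace:ℝ)^2 - 4 * A.det) := by
      apply Real.le_sqrt_of_sq_le; rw [h]; push_cast; nlinarith [sq_nonneg (A.trace:ℝ)]
    linarith

lemma unipotent_pow (A : Matrix (Fin 2) (Fin 2) ℤ) (hA : IsUnit A.det) (a : Torus 2)
    (hEnt : Dynamics.coverEntropy (torusAffine A a) Set.univ = 0) :
    (A ^ 12 - 1) * (A ^ 12 - 1) = 0 := by
  have hCH : A * A = A.trace • A - A.det • (1 : Matrix (Fin 2) (Fin 2) ℤ) := by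
    ext i j
    rw [Matrix.sub_apply, Matrix.smul_apply, Matrix.smul_apply, Matrix.mul_apply, Fin.sum_univ_two,
      Matrix.trace_fin_two, Matrix.det_fin_two, smul_eq_mul, smul_eq_mul]
    fin_cases i <;> fin_cases j <;> simp <;> ring
  have key : ∀ t d : ℤ, A * A = t • A - d • (1 : Matrix (Fin 2) (Fin 2) ℤ) →
      (d = 1 ∧ -2 ≤ t ∧ t ≤ 2) ∨ (d = -1 ∧ t = 0) → (A ^ 12 - 1) * (A ^ 12 - 1) = 0 := by
    intro t d h1 h2
    have pw : ∀ x y x' y' : ℤ, (x • A + y • (1 : Matrix (Fin 2) (Fin 2) ℤ)) * (x' • A + y' • (1 : Matrix (Fin 2) (Fin 2) ℤ))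
        = (x * x' * t + x * y' + y * x') • A + (y * y' - x * x' * d) • (1 : Matrix (Fin 2) (Fin 2) ℤ) := by
      intro x y x' y'
      simp only [add_mul, mul_add, smul_mul_smul_comm, h1, mul_one, one_mul]
      module
    have e1 : A = (1:ℤ) • A + (0:ℤ) • (1 : Matrix (Fin 2) (Fin 2) ℤ) := by simp
    have e12 : A ^ 12 = ((A * A) * A) * ((A * A) * A) * (((A * A) * A) * ((A * A) * A)) := by
      noncomm_ring
    have e0 : ∀ x y : ℤ, x • A + y • (1 : Matrix (Fin 2) (Fin 2) ℤ) - 1 = x • A + (y - 1) • (1 : Matrix (Fin 2) (Fin 2) ℤ) := by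
      intro x y; module
    rw [e12]
    have e2 : A * A = t • A + (-d) • (1 : Matrix (Fin 2) (Fin 2) ℤ) := by rw [h1]; module
    have e3 : A * A * A = (t * t + -d) • A + (- (t * d)) • (1 : Matrix (Fin 2) (Fin 2) ℤ) := by
      rw [e2]; nth_rewrite 2 [e1]; rw [pw]; congr 2 <;> ring
    rw [e3, pw, pw, e0, pw]
    rcases h2 with ⟨rfl, ha, hb⟩ | ⟨rfl, rfl⟩
    · interval_cases t <;> norm_num
    · norm_num
  exact key _ _ hCH (entropy_zero_cases A hA a hEnt)


/-- projection of a real vector to the torus -/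
def tproj (w : Fin 2 → ℝ) : Torus 2 := fun i => (w i : AddCircle (1:ℝ))

/-- real lift of the affine map -/
def liftAff (B : Matrix (Fin 2) (Fin 2) ℝ) (b : Fin 2 → ℝ) (w : Fin 2 → ℝ) : Fin 2 → ℝ :=
  B.mulVec w + b

lemma tproj_surj (x : Torus 2) : ∃ w, tproj w = x := by
  choose w hw using fun i => QuotientAddGroup.mk_surjective (x i)
  exact ⟨w, funext hw⟩

lemma tproj_lift (A : Matrix (Fin 2) (Fin 2) ℤ) (b w : Fin 2 → ℝ) :
    tproj (liftAff (A.map (fun z : ℤ => (z:ℝ))) b w) = torusAffine A (tproj b) (tproj w) := by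
  funext i
  simp only [tproj, liftAff, torusAffine, Pi.add_apply, Matrix.mulVec, dotProduct, Fin.sum_univ_two,
    Matrix.map_apply, AddCircle.coe_add]
  rw [← zsmul_eq_mul, ← zsmul_eq_mul, AddCircle.coe_zsmul, AddCircle.coe_zsmul]

lemma tproj_lift_iter (A : Matrix (Fin 2) (Fin 2) ℤ) (b w : Fin 2 → ℝ) (n : ℕ) :
    (torusAffine A (tproj b))^[n] (tproj w) = tproj ((liftAff (A.map (fun z : ℤ => (z:ℝ))) b)^[n] w) := by
  have h : Function.Semiconj tproj (liftAff (A.map (fun z : ℤ => (z:ℝ))) b) (torusAffine A (tproj b)) :=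
    fun w => tproj_lift A b w
  exact ((h.iterate_right n) w).symm

lemma lift_iter (B : Matrix (Fin 2) (Fin 2) ℝ) (b : Fin 2 → ℝ) (j : ℕ) :
    ∃ c, (liftAff B b)^[j] = liftAff (B ^ j) c := by
  induction j with
  | zero => exact ⟨0, by funext w; simp [liftAff]⟩
  | succ j ih =>
    obtain ⟨c, hc⟩ := ih
    refine ⟨B.mulVec c + b, ?_⟩
    funext w
    rw [Function.iterate_succ_apply', hc]
    simp only [liftAff, Matrix.mulVec_add, Matrix.mulVec_mulVec, pow_succ', add_assoc]

lemma unip_iter (M : Matrix (Fin 2) (Fin 2) ℝ) (hM : (M - 1) * (M - 1) = 0) (c w : Fin 2 → ℝ) (m : ℕ) :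
    (liftAff M c)^[m] w = w + (m:ℝ) • ((M - 1).mulVec w + c) + ((m:ℝ) * (m - 1) / 2) • (M - 1).mulVec c := by
  induction m with
  | zero => simp
  | succ m ih =>
    rw [Function.iterate_succ_apply', ih]
    have h0 : ∀ y : Fin 2 → ℝ, liftAff M c y = y + (M - 1).mulVec y + c := by
      intro y; simp [liftAff, Matrix.sub_mulVec]
    have h2 : ∀ y : Fin 2 → ℝ, (M - 1).mulVec ((M - 1).mulVec y) = 0 := by
      intro y; rw [Matrix.mulVec_mulVec, hM, Matrix.zero_mulVec]
    rw [h0]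
    simp only [Matrix.mulVec_add, Matrix.mulVec_smul, h2]
    push_cast
    module

lemma mFourier_tproj (k : Fin 2 → ℤ) (w : Fin 2 → ℝ) :
    UnitAddTorus.mFourier k (tproj w) = ee (k 0 * w 0 + k 1 * w 1) := by
  simp only [UnitAddTorus.mFourier, ContinuousMap.coe_mk, Fin.prod_univ_two, tproj, fourier_coe_apply]
  rw [ee_add]
  unfold ee
  congr 2 <;> · push_cast; ring

lemma phase_AP (A : Matrix (Fin 2) (Fin 2) ℤ) (hA : (A ^ 12 - 1) * (A ^ 12 - 1) = 0) (a x : Torus 2)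
    (k : Fin 2 → ℤ) (r : ℕ) : ∃ α β γ : ℝ, ∀ n : ℕ, n % 12 = r →
      UnitAddTorus.mFourier k ((torusAffine A a)^[n] x) = ee γ * qp α β n := by
  obtain ⟨b, rfl⟩ := tproj_surj a
  obtain ⟨w, rfl⟩ := tproj_surj x
  set B : Matrix (Fin 2) (Fin 2) ℝ := A.map (fun z : ℤ => (z:ℝ)) with hB
  have hM : (B ^ 12 - 1) * (B ^ 12 - 1) = 0 := by
    have hB' : B = (Int.castRingHom ℝ).mapMatrix A := rfl
    have := congrArg (Int.castRingHom ℝ).mapMatrix hA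
    rwa [map_mul, map_sub, map_pow, map_one, map_zero, ← hB'] at this
  obtain ⟨c, hc⟩ := lift_iter B b 12
  set y := (liftAff B b)^[r] w with hy
  set u := (B ^ 12 - 1).mulVec y + c with hu
  set z := (B ^ 12 - 1).mulVec c with hz
  have hit : ∀ m : ℕ, (liftAff B b)^[12 * m + r] w = y + (m:ℝ) • u + ((m:ℝ) * (m - 1) / 2) • z := by
    intro m
    rw [Function.iterate_add_apply, Function.iterate_mul, hc, unip_iter _ hM]
  set Y : ℝ := k 0 * y 0 + k 1 * y 1 with hY
  set V : ℝ := k 0 * u 0 + k 1 * u 1 with hV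
  set Z : ℝ := k 0 * z 0 + k 1 * z 1 with hZ
  refine ⟨Z / 288, V / 12 - 2 * r * Z / 288 - Z / 24, Y - V * r / 12 + Z / 288 * r ^ 2 + Z / 24 * r, fun n hn => ?_⟩
  obtain ⟨m, rfl⟩ : ∃ m, n = 12 * m + r := ⟨n / 12, by omega⟩
  rw [tproj_lift_iter, hit, mFourier_tproj]
  unfold qp
  rw [← ee_add]
  congr 1
  simp only [Pi.add_apply, Pi.smul_apply, smul_eq_mul]
  rw [hY, hV, hZ]
  push_cast
  ring

lemma char_littleO (A : Matrix (Fin 2) (Fin 2) ℤ) (hA : (A ^ 12 - 1) * (A ^ 12 - 1) = 0) (a x : Torus 2)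
    (k : Fin 2 → ℤ) :
    (fun N : ℕ => ∑ n ∈ Finset.Icc 1 N, ((ArithmeticFunction.moebius n : ℤ) : ℂ) *
      UnitAddTorus.mFourier k ((torusAffine A a)^[n] x)) =o[atTop] (fun N : ℕ => (N : ℝ)) := by
  choose α β γ h using phase_AP A hA a x k
  have e : ∀ N : ℕ, ∑ n ∈ Finset.Icc 1 N, ((ArithmeticFunction.moebius n : ℤ) : ℂ) *
      UnitAddTorus.mFourier k ((torusAffine A a)^[n] x) = ∑ r ∈ Finset.range 12, ee (γ r) *
        ∑ n ∈ Finset.Icc 1 N, if n % 12 = r % 12 then ((ArithmeticFunction.moebius n : ℤ) : ℂ) * qp (α r) (β r) n else 0 := by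
    intro N
    simp_rw [Finset.mul_sum]
    rw [Finset.sum_comm]
    refine Finset.sum_congr rfl fun n _ => ?_
    rw [Finset.sum_eq_single (n % 12)]
    · rw [if_pos (Nat.mod_mod _ _).symm, h (n % 12) n rfl]; ring
    · intro r hr hne
      rw [if_neg, mul_zero]
      rw [Nat.mod_eq_of_lt (Finset.mem_range.mp hr)]
      exact hne.symm
    · intro hn
      exact absurd (Finset.mem_range.mpr (Nat.mod_lt _ (by norm_num))) hn
  simp_rw [e]
  apply Asymptotics.IsLittleO.fun_sum
  intro r _
  exact (davenport_AP _ _ 12 r (by norm_num)).const_mul_left _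

lemma cont_littleO (A : Matrix (Fin 2) (Fin 2) ℤ) (hA : (A ^ 12 - 1) * (A ^ 12 - 1) = 0) (a x : Torus 2)
    (f : C(UnitAddTorus (Fin 2), ℂ)) :
    (fun N : ℕ => ∑ n ∈ Finset.Icc 1 N, ((ArithmeticFunction.moebius n : ℤ) : ℂ) *
      f ((torusAffine A a)^[n] x)) =o[atTop] (fun N : ℕ => (N : ℝ)) := by
  have hspan : ∀ g ∈ Submodule.span ℂ (Set.range (UnitAddTorus.mFourier (d := Fin 2))),
      (fun N : ℕ => ∑ n ∈ Finset.Icc 1 N, ((ArithmeticFunction.moebius n : ℤ) : ℂ) *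
      g ((torusAffine A a)^[n] x)) =o[atTop] (fun N : ℕ => (N : ℝ)) := by
    intro g hg
    induction hg using Submodule.span_induction with
    | mem g hg =>
      obtain ⟨k, rfl⟩ := hg
      exact char_littleO A hA a x k
    | zero => simp
    | add g g' _ _ h1 h2 =>
      refine (h1.add h2).congr_left fun N => ?_
      rw [← Finset.sum_add_distrib]
      exact Finset.sum_congr rfl fun n _ => by rw [ContinuousMap.add_apply]; ring
    | smul c g _ h1 =>
      refine (h1.const_mul_left c).congr_left fun N => ?_
      rw [Finset.mul_sum]
      exact Finset.sum_congr rfl fun n _ => by rw [ContinuousMap.smul_apply, smul_eq_mul]; ring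
  rw [Asymptotics.isLittleO_iff]
  intro ε hε
  have hf : f ∈ closure (Submodule.span ℂ (Set.range (UnitAddTorus.mFourier (d := Fin 2))) : Set C(UnitAddTorus (Fin 2), ℂ)) := by
    rw [← Submodule.topologicalClosure_coe, UnitAddTorus.span_mFourier_closure_eq_top]; trivial
  obtain ⟨g, hg, hfg⟩ := Metric.mem_closure_iff.mp hf (ε / 2) (by positivity)
  filter_upwards [(Asymptotics.isLittleO_iff.mp (hspan g hg)) (show 0 < ε / 2 by positivity)] with N hN
  have hd : ‖∑ n ∈ Finset.Icc 1 N, ((ArithmeticFunction.moebius n : ℤ) : ℂ) *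
      (f ((torusAffine A a)^[n] x) - g ((torusAffine A a)^[n] x))‖ ≤ ε / 2 * N := by
    refine (norm_sum_le _ _).trans ?_
    calc _ ≤ ∑ n ∈ Finset.Icc 1 N, ε / 2 := by
          refine Finset.sum_le_sum fun n _ => ?_
          rw [norm_mul]
          have h1 := norm_mob_le n
          have h2 : ‖f ((torusAffine A a)^[n] x) - g ((torusAffine A a)^[n] x)‖ ≤ ε / 2 := by
            rw [← dist_eq_norm]
            exact (ContinuousMap.dist_apply_le_dist _).trans hfg.le
          calc _ ≤ 1 * (ε/2) := by gcongr
            _ = _ := one_mul _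
      _ = ε / 2 * N := by simp; ring
  have e : ∑ n ∈ Finset.Icc 1 N, ((ArithmeticFunction.moebius n : ℤ) : ℂ) * f ((torusAffine A a)^[n] x) =
      ∑ n ∈ Finset.Icc 1 N, ((ArithmeticFunction.moebius n : ℤ) : ℂ) *
      (f ((torusAffine A a)^[n] x) - g ((torusAffine A a)^[n] x)) +
      ∑ n ∈ Finset.Icc 1 N, ((ArithmeticFunction.moebius n : ℤ) : ℂ) * g ((torusAffine A a)^[n] x) := by
    rw [← Finset.sum_add_distrib]
    exact Finset.sum_congr rfl fun n _ => by ring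
  rw [e]
  refine (norm_add_le _ _).trans ?_
  rw [Real.norm_natCast] at hN ⊢
  linarith


/-- The Möbius sequence is linearly disjoint from every affine flow `T x = A x + a` on the
2-torus (`A ∈ GL(2,ℤ)`) with zero topological entropy. -/
theorem moebius_linearlyDisjoint_affine_torus2_of_entropy_zero
    (A : Matrix (Fin 2) (Fin 2) ℤ) (hA : IsUnit A.det) (a : Torus 2)
    (hEnt : Dynamics.coverEntropy (torusAffine A a) Set.univ = 0) :
    LinearlyDisjoint (fun n => (ArithmeticFunction.moebius n : ℂ)) (torusAffine A a) := by
  intro f hf x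
  have h := cont_littleO A (unipotent_pow A hA a hEnt) a x ⟨f, hf⟩
  have h2 := (Asymptotics.isLittleO_norm_left.mpr h).tendsto_div_nhds_zero
  rw [tendsto_zero_iff_norm_tendsto_zero]
  refine h2.congr fun N => ?_
  rw [norm_mul, norm_div, norm_one, Complex.norm_natCast, div_eq_mul_inv, one_div, mul_comm]
  rfl
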